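/- Let p be a prime, let n be an integer with 1 ≤ n ≤ 5, and let ψ : F_p → ℂˣ be a nontrivial additive character. Let χ₁, χ₂ : F_{p^n}ˣ → ℂˣ be regular multiplicative characters such that G(χ₁·η, ψ) = G(χ₂·η, ψ) for every multiplicative character η : F_pˣ → ℂˣ. Then χ₁ and χ₂ are Frobenius-equivalent, i.e. there exists an integer j such that χ₁(x) = χ₂(x^(p^j)) for all x ∈ F_{p^n}ˣ. -/

import Mathlib

open scoped Classical

/-- The Gauss sum over `E` of the character `χ` twisted by the character `η` of the
base field `F` (pulled back via the norm map), with respect to the additive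
character `ψ` of `F` (composed with the trace map):
`G(χ·η, ψ) = ∑_{x ∈ Eˣ} χ(x) η(Nm(x)) ψ(Tr(x))`. -/
noncomputable def twistedGaussSum (F : Type) {E : Type} [Field F] [Field E] [Fintype F]
    [Fintype E] [Algebra F E] (χ : Eˣ →* ℂˣ) (η : Fˣ →* ℂˣ) (ψ : AddChar F ℂ) : ℂ :=
  ∑ x : Eˣ, ((χ x : ℂ) * (η (Units.map (Algebra.norm F : E →* F) x) : ℂ)) *
    ψ (Algebra.trace F E (x : E))

/-- A multiplicative character `χ` of `Eˣ` is *regular* if it does not factor through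
the norm map to any proper subfield of `E`. -/
def IsRegularChar {E : Type} [Field E] [Fintype E] (χ : Eˣ →* ℂˣ) : Prop :=
  ∀ K : Subfield E, K ≠ ⊤ →
    ¬ ∃ η : Kˣ →* ℂˣ, ∀ x : Eˣ, χ x = η (Units.map (Algebra.norm K : E →* K) x)

section
open Finset

/-- The truncation to degree `< N` of the power series `(1 - z) ^ (-(r + 1))`. -/
def negBinomialSum {R : Type*} [CommRing R] (N r : ℕ) (z : R) : R :=
  ∑ e ∈ range N, ((e + r).choose r : R) * z ^ e

section
variable {R : Type*} [CommRing R]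

theorem one_sub_mul_negBinomialSum (N r : ℕ) (z : R) :
    (1 - z) * negBinomialSum N (r + 1) z =
      negBinomialSum N r z - ((N + r).choose (r + 1) : R) * z ^ N := by
  induction N with
  | zero => simp [negBinomialSum]
  | succ N ih =>
    have h (s : ℕ) : negBinomialSum (N + 1) s z =
        negBinomialSum N s z + ((N + s).choose s : R) * z ^ N := by
      rw [negBinomialSum, sum_range_succ, ← negBinomialSum]
    have h1 : (N + (r + 1)).choose (r + 1) = (N + r).choose r + (N + r).choose (r + 1) := by
      rw [← add_assoc, Nat.choose_succ_succ]
    have h2 : (N + 1 + r) = N + (r + 1) := by ring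
    rw [h, h, mul_add, ih, h2, h1]
    push_cast
    ring

theorem one_sub_mul_negBinomialSum_zero (N : ℕ) (z : R) :
    (1 - z) * negBinomialSum N 0 z = 1 - z ^ N := by
  simpa [negBinomialSum] using mul_neg_geom_sum z N

theorem negBinomialSum_one (N r : ℕ) :
    negBinomialSum N r (1 : R) = ((N + r).choose (r + 1) : R) := by
  have := one_sub_mul_negBinomialSum N r (1 : R)
  simp only [sub_self, zero_mul, one_pow, mul_one] at this
  exact (sub_eq_zero.mp this.symm)

end

theorem Nat.Prime.pow_dvd_choose_pow_sub_two_add {p n r : ℕ} (hp : p.Prime)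
    (hr : 2 ≤ r) (hrp : r ≤ p + 1) (hn : 1 ≤ n) :
    p ^ (n - 1) ∣ (p ^ n - 2 + r).choose r := by
  obtain ⟨s, rfl⟩ := Nat.exists_eq_add_of_le' hr
  have hq : 2 ≤ p ^ n := hp.two_le.trans (Nat.le_self_pow (by omega) p)
  obtain ⟨Q, hQ⟩ := Nat.exists_eq_add_of_le' hq
  have hN : p ^ n - 2 + (s + 2) = Q + s + 2 := by omega
  rw [hN]
  have h1 := Nat.choose_succ_right_eq (Q + s + 2) (s + 1)
  have h2 := Nat.choose_succ_right_eq (Q + s + 2) s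
  have e1 : Q + s + 2 - (s + 1) = Q + 1 := by omega
  have e2 : Q + s + 2 - s = Q + 2 := by omega
  rw [e1] at h1
  rw [e2] at h2
  have h3 : p ^ n ∣ ((s + 1) * (s + 2)) * (Q + s + 2).choose (s + 2) := by
    refine ⟨(Q + 1) * (Q + s + 2).choose s, ?_⟩
    rw [hQ]
    calc _ = (s + 1) * ((Q + s + 2).choose (s + 1 + 1) * (s + 1 + 1)) := by ring
      _ = (Q + 1) * ((Q + s + 2).choose (s + 1) * (s + 1)) := by rw [h1]; ring
      _ = _ := by rw [h2]; ring
  have hpn : p ^ n = p * p ^ (n - 1) := by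
    rw [← pow_succ']; congr 1; omega
  have key : ∀ t : ℕ, ¬ p ∣ t → p ^ n ∣ p * (t * (Q + s + 2).choose (s + 2)) →
      p ^ (n - 1) ∣ (Q + s + 2).choose (s + 2) := fun t ht h => by
    rw [hpn] at h
    exact (((Nat.Prime.coprime_iff_not_dvd hp).mpr ht).pow_left _).dvd_of_dvd_mul_left
      (Nat.dvd_of_mul_dvd_mul_left hp.pos h)
  have hp2 := hp.two_le
  have small : ∀ t, 0 < t → t < p → ¬ p ∣ t := fun t h0 h1 => Nat.not_dvd_of_pos_of_lt h0 h1
  rcases lt_trichotomy (s + 2) p with h | h | h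
  · refine key ((s + 1) * (s + 2)) ?_ (h3.mul_left p)
    rw [hp.dvd_mul]
    exact not_or.mpr ⟨small _ (by omega) (by omega), small _ (by omega) h⟩
  · refine key (s + 1) (small _ (by omega) (by omega)) ?_
    rw [← mul_assoc, mul_comm p, ← h]
    rwa [← h] at h3
  · have h' : s + 1 = p := by omega
    refine key (s + 2) ?_ ?_
    · rw [show s + 2 = p + 1 by omega, Nat.dvd_add_right dvd_rfl]
      exact hp.one_lt.ne' ∘ Nat.dvd_one.mp
    · rw [← mul_assoc]
      rwa [h'] at h3

section
variable {R : Type*} [CommRing R]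

/-- Modulo `p ^ (n - 1)`, the truncated binomial series inverts `(1 - z) ^ r` at the nontrivial
`(p ^ n - 1)`-th roots of unity. -/
theorem one_sub_pow_mul_negBinomialSum [IsDomain R] {p n r : ℕ} (hp : p.Prime) (hn : 1 ≤ n)
    (hr : 1 ≤ r) (hrp : r ≤ p + 1) {z : R} (hz : z ≠ 1) (hzq : z ^ (p ^ n - 1) = 1) :
    (p : R) ^ (n - 1) ∣ (1 - z) ^ r * negBinomialSum (p ^ n - 1) r z - 1 := by
  have hq : 2 ≤ p ^ n := hp.two_le.trans (Nat.le_self_pow (by omega) p)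
  induction r, hr using Nat.le_induction with
  | base =>
    have h0 : negBinomialSum (p ^ n - 1) 0 z = 0 := by
      have := one_sub_mul_negBinomialSum_zero (p ^ n - 1) z
      rw [hzq, sub_self] at this
      exact (mul_eq_zero.mp this).resolve_left (sub_ne_zero.mpr hz.symm)
    rw [pow_one, one_sub_mul_negBinomialSum, h0, hzq]
    refine (pow_dvd_pow (p : R) (Nat.sub_le n 1)).trans ⟨-1, ?_⟩
    simp [Nat.cast_sub (show 1 ≤ p ^ n by omega)]
  | succ r hr ih =>
    rw [pow_succ, mul_assoc, one_sub_mul_negBinomialSum, hzq, mul_one, mul_sub, sub_right_comm]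
    refine dvd_sub (ih (by omega)) (Dvd.dvd.mul_left ?_ _)
    have := hp.pow_dvd_choose_pow_sub_two_add (n := n) (r := r + 1) (by omega) hrp hn
    rw [show p ^ n - 2 + (r + 1) = p ^ n - 1 + r by omega] at this
    exact_mod_cast Nat.cast_dvd_cast (α := R) this

end

theorem Nat.Prime.dvd_choose_mul {p i : ℕ} (hp : p.Prime) (B : ℕ) (h0 : 0 < i) (hi : i < p) :
    p ∣ (p * B).choose i := by
  rcases Nat.eq_zero_or_pos B with rfl | hB
  · simp [Nat.choose_eq_zero_of_lt h0]
  obtain ⟨m, hm⟩ := Nat.exists_eq_succ_of_ne_zero (Nat.mul_pos hp.pos hB).ne'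
  obtain ⟨k, rfl⟩ := Nat.exists_eq_succ_of_ne_zero h0.ne'
  have h := Nat.add_one_mul_choose_eq m k
  rw [← Nat.succ_eq_add_one, ← hm] at h
  have h2 : p ∣ (p * B).choose k.succ * k.succ := h ▸ (dvd_mul_right p B).mul_right _
  exact (hp.dvd_mul.mp h2).resolve_right (Nat.not_dvd_of_pos_of_lt h0 hi)

theorem Nat.Prime.choose_mul_modEq {p : ℕ} (hp : p.Prime) (B : ℕ) :
    (p * B).choose p ≡ B [MOD p ^ 2] := by
  induction B with
  | zero => simp [Nat.choose_eq_zero_of_lt hp.pos, Nat.ModEq.refl]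
  | succ B ih =>
    obtain ⟨m, hm⟩ := Nat.exists_eq_succ_of_ne_zero hp.ne_zero
    rw [mul_add, mul_one, Nat.add_choose_eq, Nat.sum_antidiagonal_eq_sum_range_succ
      (fun i j => (p * B).choose i * p.choose j), sum_range_succ]
    have hz : ∑ i ∈ range p, (p * B).choose i * p.choose (p - i) ≡ 1 [MOD p ^ 2] := by
      rw [hm, sum_range_succ', ← hm]
      have : p ^ 2 ∣ ∑ k ∈ range m, (p * B).choose (k + 1) * p.choose (p - (k + 1)) := by
        refine dvd_sum fun k hk => ?_
        have := mem_range.mp hk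
        rw [sq]
        exact mul_dvd_mul (hp.dvd_choose_mul B (by omega) (by omega))
          (hp.dvd_choose_self (by omega) (by omega))
      simpa using (Nat.modEq_zero_iff_dvd.mpr this).add_right 1
    simpa [add_comm] using (hz.add_right ((p * B).choose p)).trans (ih.add_left 1)

section
variable {R : Type*} [CommRing R]

/-- The harmonic number `1 + 1/2 + ⋯ + 1/h` in a ring in which `1, …, h` are invertible. -/
noncomputable def harmonicSum (R : Type*) [CommRing R] (h : ℕ) : R :=
  ∑ j ∈ range h, Ring.inverse ((j + 1 : ℕ) : R)

theorem harmonicSum_succ (h : ℕ) :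
    harmonicSum R (h + 1) = harmonicSum R h + Ring.inverse ((h + 1 : ℕ) : R) := by
  rw [harmonicSum, sum_range_succ, ← harmonicSum]

theorem choose_mul_add_congr {p : ℕ} (hp : p.Prime)
    (hu : ∀ t : ℕ, 0 < t → t < p → IsUnit (t : R)) (B : ℕ) {h : ℕ} (hh : h < p) :
    (p : R) ^ 2 ∣ ((p * B + h).choose p : R) - B * (1 + p * harmonicSum R h) := by
  induction h with
  | zero =>
    have := (Nat.modEq_iff_dvd.mp (hp.choose_mul_modEq B).symm)
    have := map_dvd (Int.castRingHom R) this
    simpa [harmonicSum] using this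
  | succ h ih =>
    obtain ⟨c, hc⟩ := ih (by omega)
    obtain ⟨m, rfl⟩ := Nat.exists_eq_succ_of_ne_zero hp.ne_zero
    set X := ((m + 1) * B + h).choose m
    have hX : ((m + 1) * B + h).choose (m + 1) * (m + 1 : ℕ) = X * (((m + 1) * B + h) - m) :=
      Nat.choose_succ_right_eq _ _
    have hX' : ((((m + 1) * B + h).choose (m + 1) : ℕ) : R) * ((m + 1 : ℕ) : R) =
        X * ((m + 1 : ℕ) * (B - 1) + (h + 1 : ℕ)) := by
      by_cases hle : m ≤ (m + 1) * B + h
      · have := congrArg (Nat.cast (R := R)) hX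
        push_cast [Nat.cast_sub hle] at this ⊢
        rw [this]; ring
      · have h1 : X = 0 := Nat.choose_eq_zero_of_lt (by omega)
        have h2 : ((m + 1) * B + h).choose (m + 1) = 0 := Nat.choose_eq_zero_of_lt (by omega)
        rw [h1, h2]; simp
    have hinv := Ring.mul_inverse_cancel _ (hu (h + 1) (by omega) hh)
    set v := Ring.inverse ((h + 1 : ℕ) : R)
    set P : R := ((m + 1 : ℕ) : R)
    set Y : R := ((((m + 1) * B + h).choose (m + 1) : ℕ) : R)
    have hstep : ((((m + 1) * B + (h + 1)).choose (m + 1) : ℕ) : R) = X + Y := by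
      rw [← add_assoc, Nat.choose_succ_succ]; push_cast; rfl
    rw [hstep, harmonicSum_succ]
    have e1 : (X : R) = P * (v * (Y - (B - 1) * X)) := by
      linear_combination (-(X : R)) * hinv - v * hX'
    have e2 : Y = B + P * (B * harmonicSum R h + P * c) := by linear_combination hc
    refine ⟨c + v * (B * harmonicSum R h + P * c) - v * v * (B - 1) * (Y - (B - 1) * X), ?_⟩
    linear_combination hc + e1 + P * v * e2 - P * v * (B - 1) * e1
end

theorem MulChar.sum_inv_pow_mul_pow {q : ℕ} {E R : Type*} [Field E] [Fintype E] [CommRing R]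
    [IsDomain R] {ω : MulChar E R} (hω : orderOf ω = q - 1) (hE : Fintype.card E = q) {e f : ℕ}
    (he : e < q - 1) (hf : f < q - 1) :
    ∑ y, (ω⁻¹ ^ e) y * (ω ^ f) y = if f = e then ((q - 1 : ℕ) : R) else 0 := by
  classical
  simp_rw [← MulChar.mul_apply]
  split_ifs with h
  · rw [h, inv_pow, inv_mul_cancel, MulChar.sum_one_eq_card_units, Fintype.card_units, hE]
  · refine MulChar.sum_eq_zero_of_ne_one fun h1 => h ?_
    rw [inv_pow, inv_mul_eq_one] at h1
    exact (pow_injOn_Iio_orderOf (by simpa [hω] using he) (by simpa [hω] using hf) h1).symm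

section
variable {p n : ℕ} [hp : Fact p.Prime] {E R : Type*} [Field E]
  [CommRing R] [IsDomain R] {ω : MulChar E R}

theorem inv_one_sub_pow_congr (hω : orderOf ω = p ^ n - 1) (hinj : Function.Injective ω)
    (hn : 2 ≤ n) (hω1 : ∀ y, (p : R) ∣ ω (1 - y) - (1 - ω y))
    {m : ℕ} (hm : m ≤ 2) (hmn : m ≤ n - 1) {y : E} (hy : y ≠ 0) :
    (p : R) ^ m ∣ ω⁻¹ (1 - y) ^ p - negBinomialSum (p ^ n - 1) p (ω y) := by
  have hn1 : 1 ≤ n := by omega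
  have hp2 := hp.out.two_le
  have hq : 2 ≤ p ^ n := hp2.trans (Nat.le_self_pow (by omega) p)
  by_cases h1 : y = 1
  · subst h1
    rw [sub_self, MulChar.map_zero, zero_pow hp.out.ne_zero, map_one, negBinomialSum_one, zero_sub,
      dvd_neg]
    have := hp.out.pow_dvd_choose_pow_sub_two_add (n := n) (r := p + 1) (by omega) le_rfl hn1
    rw [show p ^ n - 2 + (p + 1) = p ^ n - 1 + p by omega] at this
    exact (pow_dvd_pow _ hmn).trans (by exact_mod_cast Nat.cast_dvd_cast (α := R) this)
  · have hpow : ω y ^ (p ^ n - 1) = 1 := by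
      rw [← MulChar.pow_apply' _ (by omega), ← hω, pow_orderOf_eq_one, MulChar.one_apply hy.isUnit]
    have hc := (pow_dvd_pow _ hmn).trans (one_sub_pow_mul_negBinomialSum hp.out hn1 (by omega)
      (Nat.le_succ p) (fun h => h1 (hinj (h.trans (map_one ω).symm))) hpow)
    have hd := (pow_dvd_pow (p : R) hm).trans (by simpa using dvd_sub_pow_of_dvd_sub (hω1 y) 1)
    have hu : ω⁻¹ (1 - y) * ω (1 - y) = 1 := by
      rw [← MulChar.mul_apply, inv_mul_cancel,
        MulChar.one_apply (sub_ne_zero.mpr (Ne.symm h1)).isUnit]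
    have hu' : ω⁻¹ (1 - y) ^ p * ω (1 - y) ^ p = 1 := by rw [← mul_pow, hu, one_pow]
    convert dvd_sub (dvd_neg.mpr (hc.mul_left (ω⁻¹ (1 - y) ^ p)))
      (hd.mul_left (ω⁻¹ (1 - y) ^ p * negBinomialSum (p ^ n - 1) p (ω y))) using 1
    linear_combination (negBinomialSum (p ^ n - 1) p (ω y)) * hu'

variable [Fintype E] [CharP E p]

theorem jacobiSum_pow_congr (hω : orderOf ω = p ^ n - 1) (hinj : Function.Injective ω)
    (hn : 2 ≤ n) (hE : Fintype.card E = p ^ n) (hω1 : ∀ y, (p : R) ∣ ω (1 - y) - (1 - ω y))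
    {m : ℕ} (hm : m ≤ 2) (hmn : m ≤ n - 1) {a e : ℕ} (he : e < p ^ n - 1)
    (hae : e ≡ p * a [MOD p ^ n - 1]) :
    (p : R) ^ m ∣ jacobiSum (ω⁻¹ ^ a) ω⁻¹ + ((e + p).choose p : R) := by
  have hq : 1 ≤ p ^ n := hp.out.one_le.trans (Nat.le_self_pow (by omega) p)
  have hJ : jacobiSum (ω⁻¹ ^ a) ω⁻¹ = ∑ y, (ω⁻¹ ^ e) y * ω⁻¹ (1 - y) ^ p := by
    rw [jacobiSum, ← (frobeniusEquiv E p).toEquiv.sum_comp]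
    refine sum_congr rfl fun y _ => ?_
    have h1 : ω⁻¹ ^ e = ω⁻¹ ^ (p * a) := by
      rw [pow_eq_pow_iff_modEq, orderOf_inv, hω]; exact hae
    have h2 : 1 - y ^ p = (1 - y) ^ p := by rw [sub_pow_char, one_pow]
    simp only [RingEquiv.toEquiv_eq_coe, EquivLike.coe_coe, frobeniusEquiv_apply, frobenius_def,
      h1, h2, map_pow, mul_comm p a, pow_mul]
    rw [MulChar.pow_apply' _ hp.out.ne_zero]
  have hP : ∑ y, (ω⁻¹ ^ e) y * negBinomialSum (p ^ n - 1) p (ω y) =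
      ((p ^ n - 1 : ℕ) : R) * ((e + p).choose p : R) := by
    have : ∀ y, (ω⁻¹ ^ e) y * negBinomialSum (p ^ n - 1) p (ω y) =
        ∑ f ∈ range (p ^ n - 1), ((f + p).choose p : R) * ((ω⁻¹ ^ e) y * (ω ^ f) y) := by
      intro y
      rw [negBinomialSum, mul_sum]
      refine sum_congr rfl fun f _ => ?_
      by_cases hy : IsUnit y
      · have h1 : (ω ^ f) y = ω y ^ f := by simpa using MulChar.pow_apply_coe ω f hy.unit
        rw [h1]
        ring
      · simp [MulChar.map_nonunit _ hy]
    simp_rw [this]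
    rw [sum_comm]
    simp_rw [← mul_sum]
    rw [sum_congr rfl fun f hf => by
      rw [MulChar.sum_inv_pow_mul_pow hω hE he (mem_range.mp hf)]]
    simp [he, mul_comm]
  have hd : (p : R) ^ m ∣ jacobiSum (ω⁻¹ ^ a) ω⁻¹ -
      ((p ^ n - 1 : ℕ) : R) * ((e + p).choose p : R) := by
    rw [hJ, ← hP, ← sum_sub_distrib]
    refine dvd_sum fun y _ => ?_
    rw [← mul_sub]
    by_cases hy : y = 0
    · simp [hy, MulChar.map_zero]
    · exact (inv_one_sub_pow_congr hω hinj hn hω1 hm hmn hy).mul_left _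
  have hd2 : (p : R) ^ m ∣ (p : R) ^ n * ((e + p).choose p : R) :=
    (pow_dvd_pow _ (by omega)).mul_right _
  convert dvd_add hd hd2 using 1
  push_cast [Nat.cast_sub hq]
  ring

end

section
variable {ι : Type*}

/-- The number whose base-`p` digits are the values of `r` along the backward orbit of `u`
under `σ`. -/
def digitVal (p n : ℕ) (σ : Equiv.Perm ι) (r : ι → ℕ) (u : ι) : ℕ :=
  ∑ t ∈ range n, r ((σ⁻¹ ^ (t + 1)) u) * p ^ t

/-- `σ` is a disjoint union of cycles all of length `n`. -/
def IsUniformCycle (n : ℕ) (σ : Equiv.Perm ι) : Prop :=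
  σ ^ n = 1 ∧ ∀ t, 0 < t → t < n → ∀ i, (σ ^ t) i ≠ i

variable {p n : ℕ} {σ : Equiv.Perm ι}

theorem mul_digitVal_add (hσ : σ ^ n = 1) (r : ι → ℕ) (u : ι) :
    p * digitVal p n σ r u + r u = digitVal p n σ r (σ u) + r u * p ^ n := by
  have h (t : ℕ) : (σ⁻¹ ^ (t + 1)) (σ u) = (σ⁻¹ ^ t) u := by
    rw [pow_succ, Equiv.Perm.mul_apply, Equiv.Perm.coe_inv, Equiv.symm_apply_apply]
  have h1 : digitVal p n σ r (σ u) = ∑ t ∈ range n, r ((σ⁻¹ ^ t) u) * p ^ t := by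
    simp_rw [digitVal, h]
  have h2 := sum_range_succ (fun t => r ((σ⁻¹ ^ t) u) * p ^ t) n
  rw [sum_range_succ', ← h1] at h2
  simp only [inv_pow σ n, hσ, inv_one, Equiv.Perm.one_apply, pow_zero, mul_one] at h2
  rw [← h2, digitVal, mul_sum]
  congr 1
  exact sum_congr rfl fun t _ => by ring

theorem digitVal_add (r s : ι → ℕ) (u : ι) :
    digitVal p n σ (r + s) u = digitVal p n σ r u + digitVal p n σ s u := by
  simp [digitVal, add_mul, sum_add_distrib]

theorem IsUniformCycle.inv_pow_apply_ne (hσ : IsUniformCycle n σ) {t : ℕ} (h0 : 0 < t)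
    (ht : t < n) (i : ι) : (σ⁻¹ ^ t) i ≠ i := fun h => by
  rw [inv_pow, Equiv.Perm.inv_eq_iff_eq] at h
  exact hσ.2 t h0 ht i h.symm

theorem digitVal_single [DecidableEq ι] (hσ : IsUniformCycle n σ) (hn : 1 ≤ n) (i : ι) :
    digitVal p n σ (Pi.single i 1) (σ i) = 1 := by
  have h (t : ℕ) : (σ⁻¹ ^ (t + 1)) (σ i) = (σ⁻¹ ^ t) i := by
    rw [pow_succ, Equiv.Perm.mul_apply, Equiv.Perm.coe_inv, Equiv.symm_apply_apply]
  rw [digitVal, sum_eq_single 0]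
  · simp
  · intro t ht h0
    rw [h, Pi.single_eq_of_ne (hσ.inv_pow_apply_ne (by omega) (mem_range.mp ht) i), zero_mul]
  · simp; omega

theorem exists_pow_apply_eq [Finite ι] (hcard : Nat.card ι = n) (hσ : IsUniformCycle n σ)
    (u i : ι) : ∃ t < n, (σ⁻¹ ^ (t + 1)) u = i := by
  have hinj : Function.Injective (fun t : Fin n => (σ⁻¹ ^ (t.val + 1)) u) := by
    have key : ∀ s t : ℕ, s < t → t < n → (σ⁻¹ ^ (s + 1)) u ≠ (σ⁻¹ ^ (t + 1)) u := by
      intro s t hst ht h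
      rw [show t + 1 = (t - s) + (s + 1) by omega, pow_add σ⁻¹ (t - s), Equiv.Perm.mul_apply] at h
      exact hσ.inv_pow_apply_ne (t := t - s) (by omega) (by omega) _ h.symm
    intro s t h
    by_contra hne
    rcases lt_or_gt_of_ne (fun h => hne (Fin.ext h)) with h1 | h1
    · exact key _ _ h1 t.2 h
    · exact key _ _ h1 s.2 h.symm
  obtain ⟨t, ht⟩ := ((Nat.bijective_iff_injective_and_card _).mpr
    ⟨hinj, by rw [hcard, Nat.card_eq_fintype_card, Fintype.card_fin]⟩).surjective i
  exact ⟨t, t.2, ht⟩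

theorem digitVal_pos [Finite ι] (hcard : Nat.card ι = n) (hσ : IsUniformCycle n σ)
    (hp : 0 < p) {r : ι → ℕ} {i : ι} (hi : 0 < r i) (u : ι) :
    0 < digitVal p n σ r u := by
  obtain ⟨t, ht, h⟩ := exists_pow_apply_eq hcard hσ u i
  refine sum_pos' (fun _ _ => Nat.zero_le _) ⟨t, mem_range.mpr ht, ?_⟩
  rw [h]
  positivity

theorem digitVal_const (hp : 1 ≤ p) (u : ι) :
    digitVal p n σ (fun _ => p - 1) u = p ^ n - 1 := by
  simp only [digitVal, ← mul_sum]
  obtain ⟨k, rfl⟩ := Nat.exists_eq_add_of_le' hp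
  have := geom_sum_mul_add k n
  rw [Nat.add_sub_cancel, mul_comm]
  omega

theorem digitVal_lt [Finite ι] (hcard : Nat.card ι = n) (hσ : IsUniformCycle n σ)
    (hp : 1 ≤ p) {r : ι → ℕ} (hr : ∀ i, r i ≤ p - 1) {i : ι} (hi : r i < p - 1)
    (u : ι) : digitVal p n σ r u < p ^ n - 1 := by
  have h : (fun _ => p - 1) = r + fun i => p - 1 - r i := by
    funext j; have := hr j; simp only [Pi.add_apply]; omega
  rw [← digitVal_const (σ := σ) hp u, h, digitVal_add]
  have := digitVal_pos (p := p) hcard hσ hp (r := fun i => p - 1 - r i) (i := i)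
    (Nat.sub_pos_of_lt hi) u
  omega

/-- A cyclic system `p * X u = X (σ u) + r u * Q` has at most one solution. -/
theorem cyclic_system_unique [Fintype ι] (hp : 2 ≤ p) {Q : ℤ} {X Y : ι → ℤ} {r : ι → ℤ}
    {f : ι → ι} (hX : ∀ u, p * X u = X (f u) + r u * Q)
    (hY : ∀ u, p * Y u = Y (f u) + r u * Q) : X = Y := by
  cases isEmpty_or_nonempty ι
  · exact Subsingleton.elim _ _
  obtain ⟨u, hu⟩ := Finite.exists_max fun u => |X u - Y u|
  have h1 : p * (X u - Y u) = X (f u) - Y (f u) := by linear_combination hX u - hY u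
  have h2 : (p : ℤ) * |X u - Y u| ≤ |X u - Y u| := by
    calc (p : ℤ) * |X u - Y u| = |p * (X u - Y u)| := by rw [abs_mul, Nat.abs_cast]
      _ = |X (f u) - Y (f u)| := by rw [h1]
      _ ≤ _ := hu (f u)
  have h3 : |X u - Y u| = 0 := by
    have := abs_nonneg (X u - Y u)
    have hp' : (2 : ℤ) ≤ p := by exact_mod_cast hp
    nlinarith
  funext v
  have := hu v
  simp only [h3] at this
  exact sub_eq_zero.mp (abs_nonpos_iff.mp this)

end

section
variable {ι : Type*} [Fintype ι] {R : Type*} [CommRing R]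

/-- The second-order digit sum entering Stickelberger's congruence modulo `p ^ 2`. -/
noncomputable def harmonicDigitSum (R : Type*) [CommRing R] (σ : Equiv.Perm ι) (r : ι → ℕ) : R :=
  ∑ u, (r u : R) * harmonicSum R (r (σ u))

/-- The leading coefficient, modulo `p ^ 2`, in Stickelberger's congruence. -/
noncomputable def stickelbergerCoeff (R : Type*) [CommRing R] (p : ℕ) (σ : Equiv.Perm ι)
    (r : ι → ℕ) : R :=
  (∏ u, ((r u).factorial : R)) * (1 + p * harmonicDigitSum R σ r)

variable [DecidableEq ι] {p n : ℕ} {σ : Equiv.Perm ι}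

theorem harmonicDigitSum_add_single {r : ι → ℕ} {i : ι} (hi : σ i ≠ i) :
    harmonicDigitSum R σ (r + Pi.single i 1) = harmonicDigitSum R σ r +
      harmonicSum R (r (σ i)) + r (σ⁻¹ i) * Ring.inverse ((r i + 1 : ℕ) : R) := by
  have h1 : harmonicSum R (r (σ i)) = ∑ u, if u = i then harmonicSum R (r (σ i)) else 0 := by simp
  have h2 : r (σ⁻¹ i) * Ring.inverse ((r i + 1 : ℕ) : R) =
      ∑ u, if u = σ⁻¹ i then r (σ⁻¹ i) * Ring.inverse ((r i + 1 : ℕ) : R) else 0 := by simp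
  rw [h1, h2, harmonicDigitSum, harmonicDigitSum, ← sum_add_distrib, ← sum_add_distrib]
  refine sum_congr rfl fun u _ => ?_
  by_cases hu : u = i
  · have hσu : u ≠ σ⁻¹ i := fun h => hi (by rw [← Equiv.Perm.eq_inv_iff_eq]; exact hu ▸ h)
    subst hu
    simp only [Pi.add_apply, Pi.single_eq_same, Pi.single_eq_of_ne hi, if_true, if_neg hσu]
    push_cast
    ring_nf
  · by_cases hu' : u = σ⁻¹ i
    · have : σ u = i := Equiv.Perm.eq_inv_iff_eq.mp hu'
      rw [if_neg hu, if_pos hu', ← hu']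
      simp only [Pi.add_apply, this, Pi.single_eq_same, Pi.single_eq_of_ne hu, harmonicSum_succ]
      push_cast
      ring
    · have : σ u ≠ i := fun h => hu' (Equiv.Perm.eq_inv_iff_eq.mpr h)
      rw [if_neg hu, if_neg hu']
      simp [hu, this]

theorem stickelbergerCoeff_add_single {r : ι → ℕ} {i : ι} (hi : σ i ≠ i)
    (hu : IsUnit ((r i + 1 : ℕ) : R)) :
    (p : R) ^ 2 ∣ stickelbergerCoeff R p σ r *
        ((r i + 1 + p * r (σ⁻¹ i)) * (1 + p * harmonicSum R (r (σ i)))) -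
      stickelbergerCoeff R p σ (r + Pi.single i 1) := by
  have hprod : ∏ u, (((r + Pi.single i 1 : ι → ℕ) u).factorial : R) =
      ((r i + 1 : ℕ) : R) * ∏ u, ((r u).factorial : R) := by
    rw [← mul_prod_erase univ _ (mem_univ i), ← mul_prod_erase univ _ (mem_univ i), ← mul_assoc]
    congr 1
    · simp [Nat.factorial_succ]
    · refine prod_congr rfl fun u hu => ?_
      simp [(mem_erase.mp hu).1]
  have hinv := Ring.mul_inverse_cancel _ hu
  rw [stickelbergerCoeff, stickelbergerCoeff, hprod, harmonicDigitSum_add_single hi]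
  set v := Ring.inverse ((r i + 1 : ℕ) : R)
  set S := harmonicDigitSum R σ r
  set H := harmonicSum R (r (σ i))
  set P := ∏ u, ((r u).factorial : R)
  push_cast at hinv ⊢
  refine ⟨P * (r (σ⁻¹ i) * (S + H) + (r i + 1) * S * H + p * S * r (σ⁻¹ i) * H), ?_⟩
  linear_combination (-P * p * r (σ⁻¹ i)) * hinv

end

theorem digitVal_apply_apply_congr {ι R : Type*} [CommRing R] {p n : ℕ} {σ : Equiv.Perm ι}
    (hn : 2 ≤ n) (r : ι → ℕ) (i : ι)
    {m : ℕ} (hm : m ≤ 2) (hmn : m ≤ n - 1) :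
    ∃ b : ℕ, digitVal p n σ r (σ (σ i)) = p * b + r (σ i) ∧
      (p : R) ^ m ∣ (b : R) - (r i + p * r (σ⁻¹ i)) := by
  have e0 : (σ⁻¹ ^ 1) (σ (σ i)) = σ i := by simp
  have e1 : (σ⁻¹ ^ 2) (σ (σ i)) = i := by simp [pow_succ, Equiv.Perm.mul_apply]
  have e2 : (σ⁻¹ ^ 3) (σ (σ i)) = σ⁻¹ i := by simp [pow_succ, Equiv.Perm.mul_apply]
  obtain ⟨k, rfl⟩ := Nat.exists_eq_add_of_le' hn
  rcases Nat.eq_zero_or_pos k with rfl | hk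
  · refine ⟨r i, ?_, ?_⟩
    · simp only [digitVal, zero_add, sum_range_succ, range_zero, sum_empty, e0, e1, pow_zero,
        Nat.reduceAdd]
      ring_nf
    · refine (pow_dvd_pow (p : R) (show m ≤ 1 by omega)).trans ⟨-r (σ⁻¹ i), by ring⟩
  · obtain ⟨k, rfl⟩ := Nat.exists_eq_add_of_le' hk
    refine ⟨r i + p * r (σ⁻¹ i) + p ^ 2 *
      ∑ t ∈ range k, r ((σ⁻¹ ^ (t + 4)) (σ (σ i))) * p ^ t, ?_, ?_⟩
    · rw [digitVal, sum_range_succ', sum_range_succ', sum_range_succ']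
      simp only [zero_add, Nat.reduceAdd, e0, e1, e2, pow_zero, mul_sum, mul_add, add_assoc]
      rw [show ∑ x ∈ range k, r ((σ⁻¹ ^ (x + 4)) (σ (σ i))) * p ^ (x + 3) =
        ∑ x ∈ range k, p * (p ^ 2 * (r ((σ⁻¹ ^ (x + 4)) (σ (σ i))) * p ^ x)) from
        sum_congr rfl fun t _ => by ring]
      ring_nf
    · refine (pow_dvd_pow (p : R) hm).trans
        ⟨((∑ t ∈ range k, r ((σ⁻¹ ^ (t + 4)) (σ (σ i))) * p ^ t : ℕ) : R), ?_⟩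
      push_cast
      ring

section
variable {p n : ℕ} [hp : Fact p.Prime] {E R : Type*} [Field E] [Fintype E] [CharP E p]
  [CommRing R] {ω : MulChar E R} {ψ : AddChar E R}

theorem gaussSum_pow_mul_char (χ : MulChar E R) (hψ : ∀ x, ψ (x ^ p) = ψ x) (a : ℕ) :
    gaussSum (χ ^ (p * a)) ψ = gaussSum (χ ^ a) ψ := by
  rw [gaussSum, gaussSum, ← (frobeniusEquiv E p).toEquiv.sum_comp (fun x => (χ ^ a) x * ψ x)]
  refine sum_congr rfl fun y _ => ?_
  simp only [RingEquiv.toEquiv_eq_coe, EquivLike.coe_coe, frobeniusEquiv_apply, frobenius_def,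
    hψ, map_pow, mul_comm p a, pow_mul]
  rw [MulChar.pow_apply' _ hp.out.ne_zero]

theorem digitVal_apply_modEq {ι : Type*} {σ : Equiv.Perm ι} (hσ : σ ^ n = 1) (r : ι → ℕ) (u : ι) :
    digitVal p n σ r (σ u) ≡ p * digitVal p n σ r u [MOD p ^ n - 1] := by
  have hq : 1 ≤ p ^ n := Nat.one_le_pow _ _ hp.out.pos
  have h : p * digitVal p n σ r u = digitVal p n σ r (σ u) + (p ^ n - 1) * r u := by
    have := mul_digitVal_add (p := p) hσ r u
    zify [hq] at this ⊢
    linear_combination this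
  rw [h]
  exact (Nat.add_modulus_mul_modEq_iff.mpr rfl).symm

theorem gaussSum_pow_digitVal_eq {ι : Type*} [Finite ι] {σ : Equiv.Perm ι}
    (hcard : Nat.card ι = n) (hσ : IsUniformCycle n σ) (hω : orderOf ω = p ^ n - 1)
    (hψ : ∀ x, ψ (x ^ p) = ψ x) (r : ι → ℕ) (u v : ι) :
    gaussSum (ω⁻¹ ^ digitVal p n σ r u) ψ = gaussSum (ω⁻¹ ^ digitVal p n σ r v) ψ := by
  have hstep (u : ι) : gaussSum (ω⁻¹ ^ digitVal p n σ r (σ u)) ψ =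
      gaussSum (ω⁻¹ ^ digitVal p n σ r u) ψ := by
    rw [← gaussSum_pow_mul_char _ hψ (digitVal p n σ r u)]
    congr 1
    rw [pow_eq_pow_iff_modEq, orderOf_inv, hω]
    exact digitVal_apply_modEq hσ.1 r u
  obtain ⟨t, -, ht⟩ := exists_pow_apply_eq hcard hσ u v
  rw [← ht]
  generalize t + 1 = t
  induction t with
  | zero => simp
  | succ t ih =>
    rw [ih, ← hstep ((σ⁻¹ ^ (t + 1)) u)]
    simp [pow_succ', Equiv.Perm.mul_apply]

variable [IsDomain R]

/-- **Stickelberger's congruence** to second order: up to a factor congruent to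
`stickelbergerCoeff` modulo `p ^ m`, the Gauss sum attached to the exponent with digits `r` is
`-(-g) ^ (∑ u, r u)`, where `g` is the Gauss sum of the inverse Teichmüller character. -/
theorem exists_stickelbergerCoeff_congr {ι : Type*} [Fintype ι] [DecidableEq ι]
    {σ : Equiv.Perm ι} (hcard : Nat.card ι = n) (hσ : IsUniformCycle n σ)
    (hω : orderOf ω = p ^ n - 1) (hinj : Function.Injective ω)
    (hn : 2 ≤ n) (hE : Fintype.card E = p ^ n) (hω1 : ∀ y, (p : R) ∣ ω (1 - y) - (1 - ω y))
    (hu : ∀ t : ℕ, 0 < t → t < p → IsUnit (t : R)) (hψ1 : ψ ≠ 1) (hψ : ∀ x, ψ (x ^ p) = ψ x)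
    {m : ℕ} (hm : m ≤ 2) (hmn : m ≤ n - 1) (r : ι → ℕ) (hr : ∀ u, r u ≤ p - 1)
    (hr' : ∃ u, r u < p - 1) :
    ∃ c : R, (p : R) ^ m ∣ c - stickelbergerCoeff R p σ r ∧
      ∀ u, gaussSum (ω⁻¹ ^ digitVal p n σ r u) ψ * c = -(-gaussSum ω⁻¹ ψ) ^ ∑ i, r i := by
  have hp2 := hp.out.two_le
  induction hs : ∑ i, r i generalizing r with
  | zero =>
    have h0 : r = 0 := funext fun i => by simpa using (sum_eq_zero_iff.mp hs) i (mem_univ i)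
    subst h0
    exact ⟨1, by simp [stickelbergerCoeff, harmonicDigitSum],
      fun u => by simp [digitVal, gaussSum_one_left hψ1]⟩
  | succ s ih =>
    obtain ⟨i, hi⟩ : ∃ i, r i ≠ 0 := by
      by_contra! h
      simp [h] at hs
    obtain ⟨r, rfl⟩ : ∃ r' : ι → ℕ, r = r' + Pi.single i 1 := by
      refine ⟨r - Pi.single i 1, funext fun j => ?_⟩
      by_cases hj : j = i
      · subst hj; simp; omega
      · simp [hj]
    have hle (u : ι) : r u ≤ p - 1 := le_trans (by simp) (hr u)
    have hri : r i + 1 ≤ p - 1 := by simpa using hr i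
    have hsum : ∑ j, r j = s := by simpa [sum_add_distrib] using hs
    obtain ⟨c, hc, hG⟩ := ih r hle ⟨i, by omega⟩ hsum
    have hσi : σ i ≠ i := by simpa using hσ.2 1 one_pos (by omega) i
    have hu1 := hu (r i + 1) (by omega) (by omega)
    obtain ⟨b, hb, hbm⟩ := digitVal_apply_apply_congr (R := R) (σ := σ) hn r i hm hmn (p := p)
    have hval := digitVal_lt hcard hσ hp.out.one_le hle (i := i) (by omega) (σ (σ i))
    set a := digitVal p n σ r (σ i)
    set e := digitVal p n σ r (σ (σ i))
    have hae : e ≡ p * a [MOD p ^ n - 1] := digitVal_apply_modEq hσ.1 r (σ i)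
    have hJ := jacobiSum_pow_congr hω hinj hn hE hω1 hm hmn hval hae
    obtain ⟨j, hj⟩ := hr'
    have hval' := digitVal_lt hcard hσ hp.out.one_le hr hj
    have ha1 : digitVal p n σ (r + Pi.single i 1) (σ i) = a + 1 := by
      rw [digitVal_add, digitVal_single hσ (by omega)]
    have hne : ω⁻¹ ^ a * ω⁻¹ ≠ 1 := by
      rw [← pow_succ]
      refine pow_ne_one_of_lt_orderOf (Nat.succ_ne_zero a) ?_
      rw [orderOf_inv, hω, ← ha1]
      exact hval' _
    have hGJ := jacobiSum_mul_nontrivial hne ψ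
    rw [← pow_succ, ← ha1] at hGJ
    refine ⟨-c * jacobiSum (ω⁻¹ ^ a) ω⁻¹, ?_, ?_⟩
    · have h1 := (pow_dvd_pow (p : R) hm).trans (stickelbergerCoeff_add_single (p := p) hσi hu1)
      have h2 := (pow_dvd_pow (p : R) hm).trans
        (choose_mul_add_congr (R := R) hp.out hu (b + 1) (h := r (σ i))
          (by have := hle (σ i); omega))
      rw [show p * (b + 1) + r (σ i) = e + p by rw [hb]; ring] at h2
      push_cast at h2
      have h3 := hbm.mul_right (1 + p * harmonicSum R (r (σ i)))
      convert dvd_add (dvd_add (dvd_add (hJ.mul_left (-c)) (h2.mul_left c)) (h3.mul_left c))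
        (dvd_add (hc.mul_right ((r i + 1 + p * r (σ⁻¹ i)) * (1 + p * harmonicSum R (r (σ i)))))
          h1) using 1
      ring
    · intro u
      rw [gaussSum_pow_digitVal_eq hcard hσ hω hψ _ u (σ i), ha1]
      rw [ha1] at hGJ
      linear_combination (-c) * hGJ - gaussSum ω⁻¹ ψ * hG (σ i)
end

theorem map_harmonicSum {R S : Type*} [CommRing R] [CommRing S] (f : R →+* S) {h : ℕ}
    (hu : ∀ t : ℕ, 0 < t → t ≤ h → IsUnit (t : R)) :
    f (harmonicSum R h) = harmonicSum S h := by
  rw [harmonicSum, harmonicSum, map_sum]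
  refine sum_congr rfl fun j hj => ?_
  have h1 := hu (j + 1) j.succ_pos (mem_range.mp hj)
  obtain ⟨u, hu⟩ := h1
  have h2 : ((j + 1 : ℕ) : S) = Units.map (f : R →* S) u := by simp [hu]
  rw [← hu, h2, Ring.inverse_unit, Ring.inverse_unit, ← map_inv]
  rfl

theorem map_harmonicDigitSum {R S ι : Type*} [CommRing R] [CommRing S] [Fintype ι] (f : R →+* S)
    {σ : Equiv.Perm ι} {r : ι → ℕ} (hu : ∀ t : ℕ, 0 < t → (∃ i, t ≤ r i) → IsUnit (t : R)) :
    f (harmonicDigitSum R σ r) = harmonicDigitSum S σ r := by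
  simp only [harmonicDigitSum, map_sum, map_mul, map_natCast]
  exact sum_congr rfl fun u _ => by rw [map_harmonicSum f fun t h0 ht => hu t h0 ⟨_, ht⟩]

theorem IsLocalRing.isUnit_natCast_of_lt {R : Type*} [CommRing R] [IsLocalRing R] {p : ℕ}
    (hp : p.Prime) (hpR : ¬ IsUnit (p : R)) {t : ℕ} (h0 : 0 < t) (ht : t < p) :
    IsUnit (t : R) := by
  by_contra h
  have hc : Int.gcd t p = 1 := by
    rw [Int.gcd_natCast_natCast]; exact (Nat.coprime_of_lt_prime h0.ne' ht hp).symm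
  have hb := congrArg (Int.cast (R := R)) (Int.gcd_eq_gcd_ab t p)
  rw [hc] at hb
  push_cast at hb
  refine (IsLocalRing.mem_maximalIdeal (1 : R)).mp ?_ isUnit_one
  rw [hb]
  exact add_mem (Ideal.mul_mem_right _ _ h) (Ideal.mul_mem_right _ _ hpR)

theorem eq_and_eq_of_neg_pow_mul_eq {R : Type*} [CommRing R] [IsDomain R] {g c d : R}
    (hg : ¬ IsUnit g) (hg0 : g ≠ 0) (hc : IsUnit c) (hd : IsUnit d) {s t : ℕ}
    (h : g ^ s * c = g ^ t * d) : s = t ∧ c = d := by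
  have key : ∀ {s t : ℕ} {c d : R}, IsUnit c → g ^ s * c = g ^ t * d → s < t → False := by
    intro s t c d hc h hst
    obtain ⟨k, rfl⟩ := Nat.exists_eq_add_of_lt hst
    rw [add_assoc, pow_add, mul_assoc] at h
    have := mul_left_cancel₀ (pow_ne_zero s hg0) h
    rw [pow_succ', mul_assoc] at this
    exact hg (isUnit_of_mul_isUnit_left (this ▸ hc))
  have hst : s = t := by
    rcases lt_trichotomy s t with h1 | h1 | h1
    · exact (key hc h h1).elim
    · exact h1
    · exact (key hd h.symm h1).elim
  subst hst
  exact ⟨rfl, mul_left_cancel₀ (pow_ne_zero s hg0) h⟩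

section
variable {p n : ℕ} [hp : Fact p.Prime] {E R : Type*} [Field E] [Fintype E] [CharP E p]
  [CommRing R] [IsDomain R] [IsLocalRing R] [CharZero R] {ω : MulChar E R} {ψ : AddChar E R}

open IsLocalRing in
/-- What the equality of two Gauss sums says about the digits of their exponents. -/
theorem digits_of_gaussSum_eq {ι : Type*} [Fintype ι] {σ σ' : Equiv.Perm ι}
    (hcard : Nat.card ι = n) (hσ : IsUniformCycle n σ) (hσ' : IsUniformCycle n σ')
    (hω : orderOf ω = p ^ n - 1) (hinj : Function.Injective ω)
    (hn : 2 ≤ n) (hE : Fintype.card E = p ^ n) (hω1 : ∀ y, (p : R) ∣ ω (1 - y) - (1 - ω y))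
    (hpR : ¬ IsUnit (p : R)) (hψ1 : ψ ≠ 1) (hψ : ∀ x, ψ (x ^ p) = ψ x)
    (hg : ¬ IsUnit (gaussSum ω⁻¹ ψ)) (hg0 : gaussSum ω⁻¹ ψ ≠ 0) {r r' : ι → ℕ}
    (hr : ∀ u, r u ≤ p - 1) (hr1 : ∃ u, r u < p - 1)
    (hr' : ∀ u, r' u ≤ p - 1) (hr1' : ∃ u, r' u < p - 1) (i i' : ι)
    (h : gaussSum (ω⁻¹ ^ digitVal p n σ r i) ψ = gaussSum (ω⁻¹ ^ digitVal p n σ' r' i') ψ) :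
    ∑ u, r u = ∑ u, r' u ∧
    ((∏ u, (r u).factorial : ℕ) : ResidueField R) = ((∏ u, (r' u).factorial : ℕ) : ResidueField R) ∧
    (3 ≤ n → ∏ u, (r u).factorial = ∏ u, (r' u).factorial →
      harmonicDigitSum (ResidueField R) σ r = harmonicDigitSum (ResidueField R) σ' r') := by
  classical
  have hu (t : ℕ) (h0 : 0 < t) (ht : t < p) : IsUnit (t : R) :=
    isUnit_natCast_of_lt hp.out hpR h0 ht
  have hp2 := hp.out.two_le
  have hfact (s : ι → ℕ) (hs : ∀ u, s u ≤ p - 1) : IsUnit (∏ u, ((s u).factorial : R)) := by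
    rw [IsUnit.prod_univ_iff]
    intro u
    have := hs u
    generalize s u = t at this
    induction t with
    | zero => simp
    | succ t ih =>
      rw [Nat.factorial_succ, Nat.cast_mul]
      exact (hu _ (by omega) (by omega)).mul (ih (by omega))
  have hp0 : (p : R) ∈ maximalIdeal R := hpR
  have hmem {m : ℕ} (hm : 1 ≤ m) {x : R} (hx : (p : R) ^ m ∣ x) : x ∈ maximalIdeal R :=
    Ideal.mem_of_dvd _ ((dvd_pow_self _ (by omega)).trans hx) hp0
  have hadd {x y : R} (hx : IsUnit x) (hy : y ∈ maximalIdeal R) : IsUnit (x + y) := by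
    by_contra hxy
    have : x ∈ maximalIdeal R := by simpa using sub_mem ((mem_maximalIdeal _).mpr hxy) hy
    exact this hx
  have hcoeff (s : ι → ℕ) (hs : ∀ u, s u ≤ p - 1) (ρ : Equiv.Perm ι) :
      IsUnit (stickelbergerCoeff R p ρ s) :=
    (hfact s hs).mul (hadd isUnit_one (Ideal.mul_mem_right _ _ hp0))
  have main {m : ℕ} (hm1 : 1 ≤ m) (hm : m ≤ 2) (hmn : m ≤ n - 1) :
      ∑ u, r u = ∑ u, r' u ∧
        (p : R) ^ m ∣ stickelbergerCoeff R p σ r - stickelbergerCoeff R p σ' r' := by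
    obtain ⟨c, hc, hG⟩ := exists_stickelbergerCoeff_congr hcard hσ hω hinj hn hE hω1 hu hψ1 hψ
      hm hmn r hr hr1
    obtain ⟨c', hc', hG'⟩ := exists_stickelbergerCoeff_congr hcard hσ' hω hinj hn hE hω1 hu hψ1 hψ
      hm hmn r' hr' hr1'
    have hcu : IsUnit c := by simpa using hadd (hcoeff r hr σ) (hmem hm1 hc)
    have hcu' : IsUnit c' := by simpa using hadd (hcoeff r' hr' σ') (hmem hm1 hc')
    have h1 := hG i
    have h2 := hG' i'
    rw [← h] at h2
    obtain ⟨hs, hcc⟩ := eq_and_eq_of_neg_pow_mul_eq (g := -gaussSum ω⁻¹ ψ)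
      (by simpa using hg) (by simpa using hg0) hcu' hcu
      (s := ∑ u, r u) (t := ∑ u, r' u) (by linear_combination c' * h1 - c * h2)
    subst hcc
    refine ⟨hs, ?_⟩
    convert dvd_sub hc' hc using 1
    ring
  obtain ⟨hs, hd⟩ := main le_rfl (by omega) (by omega)
  have hpres : residue R (p : R) = 0 := (residue_eq_zero_iff _).mpr hp0
  refine ⟨hs, ?_, fun hn3 hprod => ?_⟩
  · have := (residue_eq_zero_iff _).mpr (hmem le_rfl hd)
    rw [map_sub, sub_eq_zero] at this
    have hcast (ρ : Equiv.Perm ι) (s : ι → ℕ) : residue R (stickelbergerCoeff R p ρ s) =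
        ((∏ u, (s u).factorial : ℕ) : ResidueField R) := by
      rw [stickelbergerCoeff, map_mul, map_add, map_mul, hpres, zero_mul, map_one, add_zero,
        mul_one, ← Nat.cast_prod, map_natCast]
    rwa [hcast, hcast] at this
  · obtain ⟨-, hd2⟩ := main one_le_two le_rfl (by omega)
    have hprod' : ∏ u, ((r u).factorial : R) = ∏ u, ((r' u).factorial : R) := by
      exact_mod_cast hprod
    have h3 : stickelbergerCoeff R p σ r - stickelbergerCoeff R p σ' r' =
        p * (harmonicDigitSum R σ r - harmonicDigitSum R σ' r') *
          ∏ u, ((r' u).factorial : R) := by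
      rw [stickelbergerCoeff, stickelbergerCoeff, hprod']; ring
    rw [h3, (hfact r' hr').dvd_mul_right, sq,
      mul_dvd_mul_iff_left (Nat.cast_ne_zero.mpr hp.out.ne_zero)] at hd2
    have := (residue_eq_zero_iff _).mpr (Ideal.mem_of_dvd _ hd2 hp0)
    rwa [map_sub, sub_eq_zero,
      map_harmonicDigitSum _ fun t h0 ⟨u, hu'⟩ => hu t h0 (by have := hr u; omega),
      map_harmonicDigitSum _ fun t h0 ⟨u, hu'⟩ => hu t h0 (by have := hr' u; omega)] at this
end

section
variable {n : ℕ}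

/-- Position of `u` when `Fin n` is read cyclically, starting from the block of `w`; here `st`
sends every element to the first element of its block. -/
def cutKey (st : Fin n → Fin n) (w u : Fin n) : ℕ :=
  if st w ≤ st u then u else u + n

/-- Whether the step `u ↦ σ u` goes down when reading starts from the block of `w`. -/
def cutDesc (st σ : Fin n → Fin n) (w u : Fin n) : ℕ :=
  if cutKey st w (σ u) < cutKey st w u then 1 else 0

/-- `st` sends every element to the first element of its block, for a partition of `Fin n` into
intervals. -/
def IsBlockStart (st : Fin n → Fin n) : Prop :=
  ∀ u, st u = u ∨ st u < u ∧ ∃ v, v.val + 1 = u.val ∧ st u = st v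

def NoShortCycle (σ : Fin n → Fin n) : Prop :=
  ∀ u, σ u ≠ u ∧ (3 ≤ n → σ (σ u) ≠ u)

/-- Within each block, the steps of `σ` are ordered first by whether they go down and then by
their targets. -/
def BlockMono (st σ : Fin n → Fin n) : Prop :=
  ∀ u v, u < v → st u = st v → v ≤ σ v ∧ u ≤ σ u ∧ σ u < σ v ∨ σ v < v ∧ (u ≤ σ u ∨ σ u < σ v)

def SameDesc (st σ τ : Fin n → Fin n) : Prop :=
  ∀ w u, cutDesc st σ w u = cutDesc st τ w u

/-- For some starting block, the second-order digit sums of `σ` and `τ` differ in exactly two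
terms, with distinct leading digits at these. -/
def Separated (st σ τ : Fin n → Fin n) : Prop :=
  (∀ x, st (σ x) = st (τ x)) ∧
  ∃ w u v, cutDesc st σ w (σ u) = cutDesc st σ w (τ u) + 1 ∧
    cutDesc st σ w (σ v) + 1 = cutDesc st σ w (τ v) ∧
    (∀ x, x = u ∨ x = v ∨ cutDesc st σ w (σ x) = cutDesc st σ w (τ x)) ∧
    st (σ u) = st (σ v) ∧
    (st u = st v ∧ cutDesc st σ w u ≠ cutDesc st σ w v ∨
      st u ≠ st v ∧ cutKey st w u < cutKey st w v ∧ cutDesc st σ w u ≤ cutDesc st σ w v ∨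
      st u ≠ st v ∧ cutKey st w v < cutKey st w u ∧ cutDesc st σ w v ≤ cutDesc st σ w u)

instance (st : Fin n → Fin n) : Decidable (IsBlockStart st) := by
  unfold IsBlockStart; infer_instance

instance (σ : Fin n → Fin n) : Decidable (NoShortCycle σ) := by
  unfold NoShortCycle; infer_instance

instance (st σ : Fin n → Fin n) : Decidable (BlockMono st σ) := by
  unfold BlockMono; infer_instance

instance (st σ τ : Fin n → Fin n) : Decidable (SameDesc st σ τ) := by
  unfold SameDesc; infer_instance

instance (st σ τ : Fin n → Fin n) : Decidable (Separated st σ τ) := by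
  unfold Separated; infer_instance

/-- A permutation is determined by its descents for all starting blocks, or it is separated
from the other candidates by a second-order digit sum. -/
def DescentsSeparate (n : ℕ) : Prop :=
  ∀ st : Fin n → Fin n, IsBlockStart st →
    ∀ σ : Equiv.Perm (Fin n), NoShortCycle σ → BlockMono st σ →
    ∀ τ : Equiv.Perm (Fin n), NoShortCycle τ → BlockMono st τ → SameDesc st σ τ →
      σ = τ ∨ 3 ≤ n ∧ Separated st σ τ

instance : Decidable (DescentsSeparate n) := by
  unfold DescentsSeparate; infer_instance

theorem descentsSeparate (hn : 2 ≤ n) (hn5 : n ≤ 5) : DescentsSeparate n := by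
  interval_cases n <;> decide +kernel

end

/-- The residue of `x - m * N` modulo `(p - 1) * N`, for `x < (p - 1) * N` and `m < p`. -/
def shiftVal (p N m x : ℕ) : ℕ :=
  if m ≤ x / N then x - m * N else x + (p - 1 - m) * N

/-- The leading digit `shiftVal p N m x / N` in terms of the leading digit `e = x / N`. -/
def shiftBin (p m e : ℕ) : ℕ :=
  if m ≤ e then e - m else e + (p - 1 - m)

section
variable {p N m x y : ℕ}

theorem shiftVal_div (hN : 0 < N) : shiftVal p N m x / N = shiftBin p m (x / N) := by
  unfold shiftVal shiftBin
  split_ifs with h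
  · rw [mul_comm, Nat.sub_mul_div]
  · rw [Nat.add_mul_div_right _ _ hN]

theorem shiftBin_lt {e : ℕ} (he : e < p - 1) : shiftBin p m e < p - 1 := by
  unfold shiftBin; split_ifs <;> omega

theorem shiftBin_injOn {e f : ℕ} (he : e < p - 1) (hf : f < p - 1) (hm : m ≤ p - 1)
    (h : shiftBin p m e = shiftBin p m f) : e = f := by
  unfold shiftBin at h; split_ifs at h <;> omega

theorem shiftVal_add (hm : m ≤ p - 1) :
    shiftVal p N m x + m * N = x + if m ≤ x / N then 0 else (p - 1) * N := by
  unfold shiftVal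
  split_ifs with h
  · rw [add_zero, Nat.sub_add_cancel]
    exact (Nat.mul_le_mul_right N h).trans (Nat.div_mul_le_self x N)
  · rw [add_assoc, ← add_mul, Nat.sub_add_cancel hm]

theorem shiftVal_lt (hN : 0 < N) (hx : x < (p - 1) * N) :
    shiftVal p N m x < (p - 1) * N := by
  rw [← Nat.div_lt_iff_lt_mul hN, shiftVal_div hN]
  exact shiftBin_lt ((Nat.div_lt_iff_lt_mul hN).mpr hx)

theorem shiftVal_add_modEq (hm : m ≤ p - 1) :
    shiftVal p N m x + m * N ≡ x [MOD (p - 1) * N] := by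
  rw [shiftVal_add hm]
  split_ifs
  · exact Nat.ModEq.refl _
  · simp [Nat.ModEq]

theorem shiftVal_zero : shiftVal p N 0 x = x := by simp [shiftVal]

/-- Shifting changes the order only by moving the numbers with leading digit below `m` to the
end. -/
theorem shiftVal_lt_shiftVal_iff (hm : m ≤ p - 1) (hx : x < (p - 1) * N) (hy : y < (p - 1) * N) :
    shiftVal p N m x < shiftVal p N m y ↔
      (m ≤ x / N ∧ y / N < m) ∨ ((m ≤ x / N ↔ m ≤ y / N) ∧ x < y) := by
  have h1 := shiftVal_add (p := p) (N := N) (x := x) hm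
  have h2 := shiftVal_add (p := p) (N := N) (x := y) hm
  by_cases hx' : m ≤ x / N <;> by_cases hy' : m ≤ y / N <;>
    simp only [hx', hy', if_true, if_false] at h1 h2 <;> omega

/-- The digit in a cyclic system is the leading digit, plus one at a descent. -/
theorem mul_eq_add_div_add_mul {X Y : ℕ} (hp : 1 ≤ p) (hX : X < (p - 1) * N) (hY : Y < (p - 1) * N)
    (hne : X ≠ Y) (h : p * X ≡ Y [MOD (p - 1) * N]) :
    p * X = Y + (X / N + if Y < X then 1 else 0) * ((p - 1) * N) := by
  obtain ⟨q, rfl⟩ := Nat.exists_eq_add_of_le' hp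
  rw [Nat.add_sub_cancel] at *
  have hN : 0 < N := Nat.pos_of_ne_zero fun h0 => by simp [h0] at hX
  obtain ⟨d, hd⟩ := h.symm.dvd
  have hdiv := Nat.div_add_mod X N
  have hmod := Nat.mod_lt X hN
  have hmod' : q * (X % N) < q * N := by
    refine Nat.mul_lt_mul_of_pos_left hmod (Nat.pos_of_ne_zero fun h0 => by simp [h0] at hX)
  set v := X / N
  set a := X % N
  have hd' : (X : ℤ) - Y + q * a = (q * N) * (d - v) := by
    push_cast at hd
    have : (X : ℤ) = N * v + a := by exact_mod_cast hdiv.symm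
    linear_combination hd - q * this
  have hQ : (0 : ℤ) < q * N := by exact_mod_cast (Nat.zero_le _).trans_lt hX
  have hXz : (X : ℤ) < q * N := by exact_mod_cast hX
  have hYz : (Y : ℤ) < q * N := by exact_mod_cast hY
  have haz : (q : ℤ) * a < q * N := by exact_mod_cast hmod'
  have ha0 : (0 : ℤ) ≤ q * a := by positivity
  have hX0 : (0 : ℤ) ≤ X := by positivity
  have hY0 : (0 : ℤ) ≤ Y := by positivity
  zify
  split_ifs with hlt
  · have hltz : (Y : ℤ) < X := by exact_mod_cast hlt
    have h1 : 0 < d - v := by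
      by_contra hc
      have : (q * N : ℤ) * (d - v) ≤ 0 := mul_nonpos_of_nonneg_of_nonpos hQ.le (by omega)
      omega
    have h2 : d - v < 2 := by
      by_contra hc
      have : (q * N : ℤ) * 2 ≤ (q * N : ℤ) * (d - v) := mul_le_mul_of_nonneg_left (by omega) hQ.le
      omega
    have h3 : d = v + 1 := by omega
    subst h3
    push_cast at hd ⊢
    linear_combination hd
  · have hltz : (X : ℤ) < Y := lt_of_le_of_ne (not_lt.mp hlt) (by exact_mod_cast hne)
    have h1 : -1 < d - v := by
      by_contra hc
      have : (q * N : ℤ) * (d - v) ≤ (q * N : ℤ) * (-1) :=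
        mul_le_mul_of_nonneg_left (by omega) hQ.le
      omega
    have h2 : d - v < 1 := by
      by_contra hc
      have : (q * N : ℤ) * 1 ≤ (q * N : ℤ) * (d - v) := mul_le_mul_of_nonneg_left (by omega) hQ.le
      omega
    have h3 : d = v := by omega
    subst h3
    push_cast at hd ⊢
    linear_combination hd

end

/-- The numbers `A u < (p - 1) * N`, listed increasingly, are permuted by multiplication by `p`
modulo `(p - 1) * N` in a cycle of length `n`. -/
structure IsCyclicSystem (p N : ℕ) {n : ℕ} (A : Fin n → ℕ) (σ : Equiv.Perm (Fin n)) : Prop where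
  strictMono : StrictMono A
  lt : ∀ u, A u < (p - 1) * N
  modEq : ∀ u, p * A u ≡ A (σ u) [MOD (p - 1) * N]
  cycle : IsUniformCycle n σ

/-- The base-`p` digits of the shifts by `m * N` of the members of a cyclic system. -/
def shiftDigit (p N : ℕ) {n : ℕ} (A : Fin n → ℕ) (σ : Equiv.Perm (Fin n)) (m : ℕ) (u : Fin n) :
    ℕ :=
  shiftBin p m (A u / N) + if shiftVal p N m (A (σ u)) < shiftVal p N m (A u) then 1 else 0

/-- The first index in the block of `u`, where indices are grouped by the value of `e`. -/
def blockStart {n : ℕ} (e : Fin n → ℕ) (u : Fin n) : Fin n :=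
  (univ.filter fun x => e x = e u).min' ⟨u, by simp⟩

section
variable {n : ℕ} {e : Fin n → ℕ} {u v : Fin n}

theorem apply_blockStart (e : Fin n → ℕ) (u : Fin n) : e (blockStart e u) = e u := by
  have := min'_mem (univ.filter fun x => e x = e u) ⟨u, by simp⟩
  exact (mem_filter.mp this).2

theorem blockStart_le (h : e v = e u) : blockStart e u ≤ v :=
  min'_le _ _ (by simp [h])

theorem blockStart_congr (h : e u = e v) : blockStart e u = blockStart e v :=
  le_antisymm (blockStart_le ((apply_blockStart e v).trans h.symm))
    (blockStart_le ((apply_blockStart e u).trans h))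

theorem blockStart_eq_iff : blockStart e u = blockStart e v ↔ e u = e v :=
  ⟨fun h => by rw [← apply_blockStart e u, h, apply_blockStart e v], blockStart_congr⟩

theorem blockStart_le_blockStart_iff (he : Monotone e) :
    blockStart e u ≤ blockStart e v ↔ e u ≤ e v := by
  refine ⟨fun h => ?_, fun h => ?_⟩
  · simpa [apply_blockStart] using he h
  · by_contra! hlt
    have := he hlt.le
    rw [apply_blockStart e u, apply_blockStart e v] at this
    exact hlt.ne (blockStart_congr (le_antisymm this h))

theorem isBlockStart_blockStart (he : Monotone e) : IsBlockStart (blockStart e) := by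
  intro u
  rcases (blockStart_le (e := e) (u := u) rfl).lt_or_eq with h | h
  · refine Or.inr ⟨h, ⟨u.val - 1, by omega⟩, ?_, ?_⟩
    · have : (blockStart e u).val < u.val := h
      simp only; omega
    · have h' : (blockStart e u).val < u.val := h
      refine blockStart_congr (le_antisymm ?_ (he ?_))
      · rw [← apply_blockStart e u]
        exact he (by rw [Fin.le_def]; simp only; omega)
      · rw [Fin.le_def]; simp only; omega
  · exact Or.inl h

end

/-- A monotone map is determined by the sizes of its sublevel sets. -/
theorem Monotone.eq_of_card_lt_eq {n b : ℕ} {e e' : Fin n → ℕ} (he : Monotone e)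
    (he' : Monotone e') (hb : ∀ u, e u < b) (hb' : ∀ u, e' u < b)
    (h : ∀ m ≤ b, #{u | e u < m} = #{u | e' u < m}) : e = e' := by
  have key {f g : Fin n → ℕ} (hf : Monotone f) (hg : Monotone g) (hfb : ∀ u, f u < b)
      (hc : ∀ m ≤ b, #{u | f u < m} = #{u | g u < m}) (u : Fin n) : g u ≤ f u := by
    by_contra! hlt
    have h1 : #(Iic u) ≤ #{x | f x < f u + 1} := card_le_card fun x hx => by
      have := hf (mem_Iic.mp hx)
      simp; omega
    have h2 : #{x | g x < f u + 1} ≤ #(Iio u) := card_le_card fun x hx => by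
      simp only [mem_filter, mem_univ, true_and] at hx
      refine mem_Iio.mpr (lt_of_not_ge fun hux => ?_)
      have := hg hux
      omega
    rw [Fin.card_Iic] at h1
    have h3 := hc (f u + 1) (hfb u)
    rw [Fin.card_Iio] at h2
    omega
  exact funext fun u => le_antisymm (key he' he hb' (fun m hm => (h m hm).symm) u)
    (key he he' hb h u)

/-- Two zero-one vectors of length at most five with the same sum, agreeing at two places,
agree everywhere or differ by exchanging one pair. -/
theorem exists_swap_of_sum_eq {n : ℕ} (hn5 : n ≤ 5) {c c' : Fin n → ℕ} (hc : ∀ u, c u ≤ 1)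
    (hc' : ∀ u, c' u ≤ 1) (hsum : ∑ u, c u = ∑ u, c' u) {a b : Fin n} (ha : c a = 0)
    (ha' : c' a = 0) (hb : c b = 1) (hb' : c' b = 1) :
    c = c' ∨ ∃ u v, c u = 1 ∧ c v = 0 ∧ c' u = 0 ∧ c' v = 1 ∧
      ∀ x, x ≠ u → x ≠ v → c x = c' x := by
  by_contra! hcon
  obtain ⟨hne, hsw⟩ := hcon
  set P := univ.filter fun u => c' u < c u with hP
  set M := univ.filter fun u => c u < c' u with hM
  have hPM : #P = #M := by
    have h1 : ∀ u, (c u : ℤ) - c' u =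
        (if c' u < c u then 1 else 0) - if c u < c' u then 1 else 0 := by
      intro u; have := hc u; have := hc' u
      split_ifs <;> omega
    have h2 : ∑ u, ((c u : ℤ) - c' u) = 0 := by
      rw [sum_sub_distrib, sub_eq_zero]; exact_mod_cast hsum
    simp_rw [h1, sum_sub_distrib, sum_boole] at h2
    have : ((#P : ℤ)) = #M := by simpa using sub_eq_zero.mp h2
    exact_mod_cast this
  have hdisj : Disjoint P M := disjoint_filter.mpr fun u _ h => by omega
  have hsub : P ∪ M ⊆ (univ.erase a).erase b := fun u hu => by
    simp only [hP, hM, mem_union, mem_filter, mem_univ, true_and] at hu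
    simp only [mem_erase, mem_univ, and_true]
    constructor <;> rintro rfl <;> omega
  have hab : b ≠ a := by rintro rfl; omega
  have hcard := card_le_card hsub
  rw [card_union_of_disjoint hdisj, card_erase_of_mem (by simp [hab]), card_erase_of_mem (by simp),
    card_univ, Fintype.card_fin] at hcard
  rcases Nat.eq_zero_or_pos #P with h0 | h0
  · refine hne (funext fun u => ?_)
    have h1 : u ∉ P := by simp [card_eq_zero.mp h0]
    have h2 : u ∉ M := by simp [card_eq_zero.mp (hPM ▸ h0)]
    simp only [hP, hM, mem_filter, mem_univ, true_and, not_lt] at h1 h2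
    exact le_antisymm h1 h2
  · obtain ⟨u, hu⟩ := card_eq_one.mp (show #P = 1 by omega)
    obtain ⟨v, hv⟩ := card_eq_one.mp (show #M = 1 by omega)
    have hu' : u ∈ P := by simp [hu]
    have hv' : v ∈ M := by simp [hv]
    simp only [hP, hM, mem_filter, mem_univ, true_and] at hu' hv'
    have := hc u
    have := hc' v
    obtain ⟨x, hxu, hxv, hx⟩ := hsw u v (by omega) (by omega) (by omega) (by omega)
    have h1 : x ∉ P := by simp [hu, hxu]
    have h2 : x ∉ M := by simp [hv, hxv]
    simp only [hP, hM, mem_filter, mem_univ, true_and, not_lt] at h1 h2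
    exact hx (le_antisymm h1 h2)

namespace IsCyclicSystem
variable {p N n m : ℕ} {A : Fin n → ℕ} {σ : Equiv.Perm (Fin n)}

theorem pos (hA : IsCyclicSystem p N A σ) (u : Fin n) : 0 < N :=
  Nat.pos_of_ne_zero fun h => by simpa [h] using hA.lt u

theorem bin_lt (hA : IsCyclicSystem p N A σ) (u : Fin n) : A u / N < p - 1 :=
  (Nat.div_lt_iff_lt_mul (hA.pos u)).mpr (hA.lt u)

theorem bin_mono (hA : IsCyclicSystem p N A σ) : Monotone fun u => A u / N :=
  fun _ _ h => Nat.div_le_div_right (hA.strictMono.monotone h)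

theorem shiftVal_lt_iff (hA : IsCyclicSystem p N A σ) (hm : m ≤ p - 1) {u v : Fin n} :
    shiftVal p N m (A u) < shiftVal p N m (A v) ↔
      (m ≤ A u / N ∧ A v / N < m) ∨ ((m ≤ A u / N ↔ m ≤ A v / N) ∧ u < v) := by
  rw [shiftVal_lt_shiftVal_iff hm (hA.lt u) (hA.lt v), hA.strictMono.lt_iff_lt]

theorem shiftVal_injective (hA : IsCyclicSystem p N A σ) (hm : m ≤ p - 1) :
    Function.Injective fun u => shiftVal p N m (A u) := by
  intro u v h
  have h1 := (hA.shiftVal_lt_iff hm (u := u) (v := v)).not.mp (by simp only at h; omega)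
  have h2 := (hA.shiftVal_lt_iff hm (u := v) (v := u)).not.mp (by simp only at h; omega)
  by_contra hne
  have : u < v ∨ v < u := lt_or_gt_of_ne hne
  simp only [← not_le] at *
  tauto

theorem apply_ne (hA : IsCyclicSystem p N A σ) (hn : 2 ≤ n) (u : Fin n) : σ u ≠ u := by
  simpa using hA.cycle.2 1 one_pos (by omega) u

theorem noShortCycle (hA : IsCyclicSystem p N A σ) (hn : 2 ≤ n) : NoShortCycle σ :=
  fun u => ⟨hA.apply_ne hn u, fun hn3 => by
    simpa [sq] using hA.cycle.2 2 two_pos (by omega) u⟩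

theorem mul_shiftVal (hA : IsCyclicSystem p N A σ) (hn : 2 ≤ n) (hp : 1 ≤ p) (hm : m ≤ p - 1)
    (u : Fin n) : p * shiftVal p N m (A u) =
      shiftVal p N m (A (σ u)) + shiftDigit p N A σ m u * ((p - 1) * N) := by
  have hN := hA.pos u
  rw [mul_eq_add_div_add_mul hp (shiftVal_lt hN (hA.lt u)) (shiftVal_lt hN (hA.lt (σ u)))
    (fun h => hA.apply_ne hn u (hA.shiftVal_injective hm h).symm), shiftVal_div hN, shiftDigit]
  have h1 := (shiftVal_add_modEq (N := N) (x := A u) hm).mul_left p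
  have h2 := shiftVal_add_modEq (N := N) (x := A (σ u)) hm
  have h3 := (h1.trans (hA.modEq u)).trans h2.symm
  have h4 : p * (m * N) = m * N + m * ((p - 1) * N) := by
    obtain ⟨q, rfl⟩ := Nat.exists_eq_add_of_le' hp
    rw [Nat.add_sub_cancel]; ring
  rw [mul_add, h4, ← add_assoc] at h3
  refine Nat.ModEq.add_right_cancel' (m * N) (Nat.ModEq.trans ?_ h3)
  simp [Nat.ModEq]

theorem shiftDigit_le (hA : IsCyclicSystem p N A σ) (u : Fin n) :
    shiftDigit p N A σ m u ≤ p - 1 := by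
  have := shiftBin_lt (m := m) (hA.bin_lt u)
  unfold shiftDigit
  split_ifs <;> omega

theorem shiftDigit_of_forall_le {u : Fin n}
    (h : ∀ v, shiftVal p N m (A u) ≤ shiftVal p N m (A v)) :
    shiftDigit p N A σ m u = shiftBin p m (A u / N) := by
  rw [shiftDigit, if_neg (h _).not_gt, add_zero]

theorem exists_shiftDigit_lt (hA : IsCyclicSystem p N A σ) (hn : 2 ≤ n) :
    ∃ u, shiftDigit p N A σ m u < p - 1 := by
  have : Nonempty (Fin n) := ⟨⟨0, by omega⟩⟩
  obtain ⟨u, hu⟩ := Finite.exists_min fun u => shiftVal p N m (A u)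
  exact ⟨u, by rw [shiftDigit_of_forall_le hu]; exact shiftBin_lt (hA.bin_lt u)⟩

theorem digitVal_shiftDigit (hA : IsCyclicSystem p N A σ) (hn : 2 ≤ n) (hp : 2 ≤ p)
    (hm : m ≤ p - 1) (hN : (p - 1) * N = p ^ n - 1) (u : Fin n) :
    digitVal p n σ (shiftDigit p N A σ m) u = shiftVal p N m (A u) := by
  have hpn : 1 ≤ p ^ n := Nat.one_le_pow _ _ (by omega)
  have h1 (u : Fin n) := mul_digitVal_add (p := p) hA.cycle.1 (shiftDigit p N A σ m) u
  have h2 (u : Fin n) := hA.mul_shiftVal hn (by omega) hm u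
  have := cyclic_system_unique (f := σ) hp (Q := (p : ℤ) ^ n - 1)
    (X := fun u => digitVal p n σ (shiftDigit p N A σ m) u) (Y := fun u => shiftVal p N m (A u))
    (r := fun u => shiftDigit p N A σ m u)
    (fun u => by
      have := h1 u
      zify at this
      linear_combination this)
    (fun u => by
      have := h2 u
      rw [hN] at this
      zify [hpn] at this
      linear_combination this)
  exact_mod_cast congrFun this u

theorem shiftDigit_le_of_le (hA : IsCyclicSystem p N A σ) (hn : 2 ≤ n) (hp : 1 ≤ p)
    (hm : m ≤ p - 1) {u v : Fin n} (h : shiftVal p N m (A u) ≤ shiftVal p N m (A v)) :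
    shiftDigit p N A σ m u ≤ shiftDigit p N A σ m v := by
  by_contra! hlt
  have h1 := hA.mul_shiftVal hn hp hm u
  have h2 := hA.mul_shiftVal hn hp hm v
  have h3 := shiftVal_lt (m := m) (hA.pos u) (hA.lt (σ v))
  have h4 := Nat.mul_le_mul_right ((p - 1) * N) (Nat.succ_le_of_lt hlt)
  have h5 := Nat.mul_le_mul_left p h
  rw [Nat.succ_mul] at h4
  omega

theorem blockMono (hA : IsCyclicSystem p N A σ) (hn : 2 ≤ n) (hp : 1 ≤ p) :
    BlockMono (blockStart fun u => A u / N) σ := by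
  intro u v huv hst
  have he : A u / N = A v / N := (blockStart_eq_iff (e := fun u => A u / N)).mp hst
  have h1 := hA.mul_shiftVal hn hp (Nat.zero_le _) u
  have h2 := hA.mul_shiftVal hn hp (Nat.zero_le _) v
  have hlt := hA.strictMono huv
  have hle : shiftDigit p N A σ 0 u ≤ shiftDigit p N A σ 0 v :=
    hA.shiftDigit_le_of_le hn hp (Nat.zero_le _) (by simpa [shiftVal_zero] using hlt.le)
  have h3 : shiftDigit p N A σ 0 u = shiftDigit p N A σ 0 v → σ u < σ v := by
    intro h
    rw [h, shiftVal_zero, shiftVal_zero] at h1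
    rw [shiftVal_zero, shiftVal_zero] at h2
    have h5 := Nat.mul_lt_mul_of_pos_left hlt (show 0 < p by omega)
    rw [← hA.strictMono.lt_iff_lt]
    omega
  simp only [shiftDigit, shiftVal_zero, he, hA.strictMono.lt_iff_lt] at hle h3
  rcases lt_or_ge (σ u) u with hu | hu <;> rcases lt_or_ge (σ v) v with hv | hv <;>
    simp only [hu, hv, hu.not_gt, hv.not_gt, if_true, if_false, add_right_inj,
      zero_ne_one, one_ne_zero, true_imp_iff, true_and, true_or, or_true] at hle h3 ⊢
  · exact Or.inr (Or.inr h3)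
  · omega
  · exact Or.inl h3

theorem cutKey_lt_iff (hA : IsCyclicSystem p N A σ) (w u v : Fin n) :
    cutKey (blockStart fun u => A u / N) w u < cutKey (blockStart fun u => A u / N) w v ↔
      shiftVal p N (A w / N) (A u) < shiftVal p N (A w / N) (A v) := by
  rw [hA.shiftVal_lt_iff (hA.bin_lt w).le, cutKey, cutKey]
  simp only [blockStart_le_blockStart_iff hA.bin_mono]
  split_ifs <;> omega

theorem shiftDigit_bin (hA : IsCyclicSystem p N A σ) (w u : Fin n) :
    shiftDigit p N A σ (A w / N) u = shiftBin p (A w / N) (A u / N) +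
      cutDesc (blockStart fun u => A u / N) σ w u := by
  rw [shiftDigit, cutDesc]
  simp only [hA.cutKey_lt_iff]

end IsCyclicSystem

/-- The invariants of a digit system that are visible from its Gauss sum. -/
def SameDigitSums (K : Type*) [Field K] {n : ℕ} (σ σ' : Equiv.Perm (Fin n))
    (r r' : Fin n → ℕ) : Prop :=
  ∑ u, r u = ∑ u, r' u ∧
    ((∏ u, (r u).factorial : ℕ) : K) = ((∏ u, (r' u).factorial : ℕ) : K) ∧
    (3 ≤ n → ∏ u, (r u).factorial = ∏ u, (r' u).factorial →
      harmonicDigitSum K σ r = harmonicDigitSum K σ' r')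

theorem eq_of_prod_factorial_swap {K : Type*} [Field K] {p : ℕ} [Fact p.Prime] [CharP K p]
    {n : ℕ} {v c c' : Fin n → ℕ} (hv : ∀ x, v x < p - 1) {a b : Fin n} (ha : c a = 1)
    (hb : c b = 0) (ha' : c' a = 0) (hb' : c' b = 1) (hc' : ∀ x, c' x ≤ 1)
    (hx : ∀ x, x ≠ a → x ≠ b → c x = c' x)
    (h : ((∏ u, (v u + c u).factorial : ℕ) : K) = ((∏ u, (v u + c' u).factorial : ℕ) : K)) :
    v a = v b := by
  have hab : b ≠ a := by rintro rfl; omega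
  have hf (k : ℕ) (hk : k < p) : ((k.factorial : ℕ) : K) ≠ 0 := fun h0 => by
    rw [CharP.cast_eq_zero_iff K p, (Fact.out : p.Prime).dvd_factorial] at h0
    omega
  have hsplit (f : Fin n → ℕ) :
      ∏ u, f u = f a * (f b * ∏ u ∈ (univ.erase a).erase b, f u) := by
    rw [mul_prod_erase (univ.erase a) _ (by simp [hab]), mul_prod_erase univ _ (mem_univ a)]
  have hrest : ∏ u ∈ (univ.erase a).erase b, (v u + c u).factorial =
      ∏ u ∈ (univ.erase a).erase b, (v u + c' u).factorial :=
    prod_congr rfl fun x hx' => by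
      simp only [mem_erase, mem_univ, and_true] at hx'
      rw [hx x hx'.2 hx'.1]
  have hrest0 : ((∏ u ∈ (univ.erase a).erase b, (v u + c' u).factorial : ℕ) : K) ≠ 0 := by
    rw [Nat.cast_prod, prod_ne_zero_iff]
    intro x hx'
    simp only [mem_erase, mem_univ, and_true] at hx'
    have := hv x
    have := hc' x
    exact hf _ (by omega)
  rw [hsplit, hsplit, hrest] at h
  simp only [ha, hb, ha', hb', add_zero, Nat.factorial_succ] at h
  generalize ∏ u ∈ (univ.erase a).erase b, (v u + c' u).factorial = P at h hrest0
  rw [← sub_eq_zero] at h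
  have h1 := hf (v a) (by have := hv a; omega)
  have h2 := hf (v b) (by have := hv b; omega)
  have h3 : ((v a + 1 : ℕ) : K) = ((v b + 1 : ℕ) : K) := by
    refine mul_right_cancel₀ (mul_ne_zero h1 (mul_ne_zero h2 hrest0)) ?_
    push_cast at h ⊢
    linear_combination h
  have := CharP.natCast_injOn_Iio K p (by simp only [Set.mem_Iio]; have := hv a; omega)
    (by simp only [Set.mem_Iio]; have := hv b; omega) h3
  omega

namespace IsCyclicSystem
variable {p N n : ℕ} {A A' : Fin n → ℕ} {σ σ' : Equiv.Perm (Fin n)}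

theorem sum_add_eq (hA : IsCyclicSystem p N A σ) (hn : 2 ≤ n) (hp : 2 ≤ p) {m : ℕ}
    (hm : m ≤ p - 1) : (∑ u, shiftDigit p N A σ m u) * N + n * (m * N) =
      ∑ u, A u + (n - #{u | m ≤ A u / N}) * ((p - 1) * N) := by
  have h1 : (p - 1) * ∑ u, shiftVal p N m (A u) =
      (p - 1) * ((∑ u, shiftDigit p N A σ m u) * N) := by
    have := sum_congr rfl fun u (_ : u ∈ univ) => hA.mul_shiftVal hn (by omega) hm u
    rw [sum_add_distrib, ← mul_sum, ← sum_mul,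
      Equiv.sum_comp σ fun u => shiftVal p N m (A u)] at this
    rw [Nat.sub_mul, one_mul, this, Nat.add_sub_cancel_left]
    ring
  have h2 := sum_congr rfl fun u (_ : u ∈ univ) =>
    shiftVal_add (p := p) (N := N) (x := A u) hm
  rw [sum_add_distrib, sum_add_distrib, Nat.eq_of_mul_eq_mul_left (by omega) h1] at h2
  simp only [sum_const, card_univ, Fintype.card_fin, smul_eq_mul] at h2
  rw [h2, sum_ite, sum_const_zero, zero_add, sum_const, smul_eq_mul, filter_not,
    card_sdiff_of_subset (filter_subset _ _), card_univ, Fintype.card_fin]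

theorem bin_eq (hA : IsCyclicSystem p N A σ) (hA' : IsCyclicSystem p N A' σ') (hn : 2 ≤ n)
    (hp : 2 ≤ p) (h : ∀ m ≤ p - 1,
      ∑ u, shiftDigit p N A σ m u = ∑ u, shiftDigit p N A' σ' m u) (u : Fin n) :
    A u / N = A' u / N := by
  have hN := hA.pos u
  have hsum : ∑ u, A u = ∑ u, A' u := by
    have h1 := hA.sum_add_eq hn hp (Nat.zero_le _)
    have h2 := hA'.sum_add_eq hn hp (Nat.zero_le _)
    rw [h 0 (Nat.zero_le _), h2] at h1
    simpa using h1.symm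
  refine congrFun (hA.bin_mono.eq_of_card_lt_eq hA'.bin_mono hA.bin_lt hA'.bin_lt
    fun m hm => ?_) u
  have h1 := hA.sum_add_eq hn hp hm
  have h2 := hA'.sum_add_eq hn hp hm
  rw [h m hm, h2, hsum] at h1
  have h3 := Nat.eq_of_mul_eq_mul_right (Nat.mul_pos (by omega) hN) (Nat.add_left_cancel h1)
  have key (f : Fin n → ℕ) : #{u | f u < m} = n - #{u | m ≤ f u} := by
    have := card_sdiff_of_subset (filter_subset (fun u => m ≤ f u) univ)
    rw [← filter_not, card_univ, Fintype.card_fin] at this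
    simpa using this
  rw [key, key, h3]

end IsCyclicSystem

namespace IsCyclicSystem
variable {p N n : ℕ} {A A' : Fin n → ℕ} {σ σ' : Equiv.Perm (Fin n)}

theorem cutDesc_le (st ρ : Fin n → Fin n) (w u : Fin n) : cutDesc st ρ w u ≤ 1 := by
  unfold cutDesc; split_ifs <;> omega

theorem cutDesc_eq_zero (ρ : Fin n → Fin n) {st : Fin n → Fin n} {w u : Fin n}
    (h : ∀ v, cutKey st w u ≤ cutKey st w v) : cutDesc st ρ w u = 0 :=
  if_neg (h _).not_gt

theorem cutKey_injective (st : Fin n → Fin n) (w : Fin n) : Function.Injective (cutKey st w) := by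
  intro u v h
  unfold cutKey at h
  split_ifs at h <;> omega

theorem cutDesc_eq_one {ρ : Fin n → Fin n} {st : Fin n → Fin n} {w u : Fin n} (hρ : ρ u ≠ u)
    (h : ∀ v, cutKey st w v ≤ cutKey st w u) : cutDesc st ρ w u = 1 :=
  if_pos ((h _).lt_of_ne fun h => hρ (cutKey_injective st w h))

theorem sameDesc {K : Type*} [Field K] [hp : Fact p.Prime] [CharP K p]
    (hA : IsCyclicSystem p N A σ) (hA' : IsCyclicSystem p N A' σ') (hn : 2 ≤ n) (hn5 : n ≤ 5)
    (hbin : ∀ u, A u / N = A' u / N)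
    (h : ∀ m ≤ p - 1, SameDigitSums K σ σ' (shiftDigit p N A σ m) (shiftDigit p N A' σ' m)) :
    SameDesc (blockStart fun u => A u / N) σ σ' := by
  intro w
  have hp1 := hp.out.one_lt
  have hw : A w / N ≤ p - 1 := (hA.bin_lt w).le
  have hbin' : (fun u => A' u / N) = fun u => A u / N := funext fun u => (hbin u).symm
  obtain ⟨hs, hprod, -⟩ := h _ hw
  have e1 (u : Fin n) := hA.shiftDigit_bin w u
  have e2 (u : Fin n) : shiftDigit p N A' σ' (A w / N) u = shiftBin p (A w / N) (A u / N) +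
      cutDesc (blockStart fun u => A u / N) σ' w u := by
    rw [hbin w, hA'.shiftDigit_bin, hbin', hbin u]
  have hval (u v : Fin n) (huv : u < v) (he : A u / N = A v / N) :
      cutDesc (blockStart fun u => A u / N) σ w u ≤
        cutDesc (blockStart fun u => A u / N) σ w v := by
    have := hA.shiftDigit_le_of_le (u := u) (v := v) hn hp1.le hw
      ((hA.shiftVal_lt_iff hw).mpr (Or.inr ⟨by rw [he], huv⟩)).le
    rw [e1, e1, he] at this
    omega
  have hval' (u v : Fin n) (huv : u < v) (he : A u / N = A v / N) :
      cutDesc (blockStart fun u => A u / N) σ' w u ≤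
        cutDesc (blockStart fun u => A u / N) σ' w v := by
    have := hA'.shiftDigit_le_of_le (u := u) (v := v) hn hp1.le hw
      ((hA'.shiftVal_lt_iff hw).mpr (Or.inr ⟨by rw [← hbin u, he, hbin v], huv⟩)).le
    rw [e2, e2, he] at this
    omega
  have : Nonempty (Fin n) := ⟨⟨0, by omega⟩⟩
  set st := blockStart fun u => A u / N
  obtain ⟨a, ha⟩ := Finite.exists_min (cutKey st w)
  obtain ⟨b, hb⟩ := Finite.exists_max (cutKey st w)
  simp only [e1, e2] at hs hprod
  rw [sum_add_distrib, sum_add_distrib, Nat.add_left_cancel_iff] at hs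
  refine fun u => ?_
  rcases exists_swap_of_sum_eq hn5 (cutDesc_le st σ w) (cutDesc_le st σ' w) hs
    (cutDesc_eq_zero σ ha) (cutDesc_eq_zero σ' ha) (cutDesc_eq_one (hA.apply_ne hn b) hb)
    (cutDesc_eq_one (hA'.apply_ne hn b) hb) with heq | ⟨u, v, h1, h2, h3, h4, hx⟩
  · exact congrFun heq u
  · exfalso
    have := eq_of_prod_factorial_swap (K := K) (p := p)
      (v := fun u => shiftBin p (A w / N) (A u / N)) (fun x => shiftBin_lt (hA.bin_lt x))
      h1 h2 h3 h4
      (cutDesc_le st σ' w) hx hprod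
    have he := shiftBin_injOn (hA.bin_lt u) (hA.bin_lt v) hw this
    rcases lt_trichotomy u v with huv | rfl | huv
    · have := hval u v huv he; omega
    · omega
    · have := hval' v u huv he.symm; omega

theorem not_separated {K : Type*} [Field K] [hp : Fact p.Prime] [CharP K p]
    (hA : IsCyclicSystem p N A σ) (hA' : IsCyclicSystem p N A' σ') (hn : 3 ≤ n)
    (hbin : ∀ u, A u / N = A' u / N)
    (hdesc : SameDesc (blockStart fun u => A u / N) σ σ')
    (h : ∀ m ≤ p - 1, SameDigitSums K σ σ' (shiftDigit p N A σ m) (shiftDigit p N A' σ' m)) :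
    ¬Separated (blockStart fun u => A u / N) σ σ' := by
  rintro ⟨hst, w, u, v, hu, hv, hx, huv, hcase⟩
  have hw : A w / N ≤ p - 1 := (hA.bin_lt w).le
  have hbin' : (fun u => A' u / N) = fun u => A u / N := funext fun u => (hbin u).symm
  have hr : shiftDigit p N A' σ' (A w / N) = shiftDigit p N A σ (A w / N) := by
    funext x
    rw [hA.shiftDigit_bin, hbin, hA'.shiftDigit_bin, hbin', hbin x, hdesc w x]
  have hH := (h _ hw).2.2 hn (by rw [hr])
  rw [hr, harmonicDigitSum, harmonicDigitSum, ← sub_eq_zero, ← sum_sub_distrib] at hH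
  have e (x : Fin n) := hA.shiftDigit_bin w x
  have hkey (x y : Fin n) := hA.cutKey_lt_iff w x y
  have hle (x : Fin n) : shiftDigit p N A σ (A w / N) x < p := by
    have := hA.shiftDigit_le (m := A w / N) x; have := hp.out.pos; omega
  have hlt (x : Fin n) := shiftBin_lt (m := A w / N) (hA.bin_lt x)
  have hbs (x y : Fin n) := blockStart_eq_iff (e := fun u => A u / N) (u := x) (v := y)
  set st := blockStart fun u => A u / N
  set r := shiftDigit p N A σ (A w / N)
  have hne : u ≠ v := by
    rintro rfl; omega
  have hd (x : Fin n) (hx' : cutDesc st σ w (σ x) = cutDesc st σ w (σ' x)) :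
      r (σ x) = r (σ' x) := by
    rw [e, e, hx', (hbs _ _).mp (hst x)]
  have hb := cutDesc_le st σ w
  have hu1 : r (σ u) = r (σ' u) + 1 := by
    rw [e, e, hu, (hbs _ _).mp (hst u), add_assoc]
  have hv1 : r (σ' v) = r (σ v) + 1 := by
    rw [e, e, ← hv, (hbs _ _).mp (hst v), add_assoc]
  have huv1 : r (σ' u) = r (σ v) := by
    have h1 := hb (σ u)
    have h2 := hb (σ' v)
    rw [e, e, ← (hbs _ _).mp (hst u), (hbs _ _).mp huv]
    omega
  rw [← add_sum_erase _ _ (mem_univ u), ← add_sum_erase (univ.erase u) _ (mem_erase.mpr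
    ⟨hne.symm, mem_univ v⟩), sum_eq_zero (s := (univ.erase u).erase v) fun x hx' => by
      simp only [mem_erase, mem_univ, and_true] at hx'
      rw [hd x (((hx x).resolve_left hx'.2).resolve_left hx'.1), sub_self], hu1, hv1, huv1,
    harmonicSum_succ] at hH
  have hunit : ((r (σ v) + 1 : ℕ) : K) ≠ 0 := fun h0 => by
    rw [CharP.cast_eq_zero_iff K p] at h0
    have h1 := Nat.le_of_dvd (Nat.succ_pos _) h0
    have h2 := hle (σ' v)
    omega
  rw [Ring.inverse_eq_inv] at hH
  have hruv : (r u : K) = r v := by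
    refine mul_right_cancel₀ (inv_ne_zero hunit) ?_
    linear_combination hH
  have hruv' : r u = r v := CharP.natCast_injOn_Iio K p (hle u) (hle v) hruv
  have hmono (x y : Fin n) (hxy : st x ≠ st y) (hk : cutKey st w x < cutKey st w y)
      (hc : cutDesc st σ w x ≤ cutDesc st σ w y) : r x ≠ r y := by
    have h1 := Nat.div_le_div_right (c := N) ((hkey x y).mp hk).le
    rw [shiftVal_div (hA.pos x), shiftVal_div (hA.pos x)] at h1
    have h2 : shiftBin p (A w / N) (A x / N) ≠ shiftBin p (A w / N) (A y / N) := fun h =>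
      hxy ((hbs _ _).mpr (shiftBin_injOn (hA.bin_lt x) (hA.bin_lt y) hw h))
    rw [e, e]
    omega
  rcases hcase with ⟨h1, h2⟩ | ⟨h1, h2, h3⟩ | ⟨h1, h2, h3⟩
  · rw [e, e, (hbs _ _).mp h1] at hruv'
    omega
  · exact hmono u v h1 h2 h3 hruv'
  · exact hmono v u (Ne.symm h1) h2 h3 hruv'.symm

/-- A cyclic system of size at most five is determined by the digit sums of its shifts. -/
theorem eq_of_sameDigitSums {K : Type*} [Field K] [hp : Fact p.Prime] [CharP K p]
    (hA : IsCyclicSystem p N A σ) (hA' : IsCyclicSystem p N A' σ') (hn : 2 ≤ n) (hn5 : n ≤ 5)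
    (h : ∀ m ≤ p - 1, SameDigitSums K σ σ' (shiftDigit p N A σ m) (shiftDigit p N A' σ' m)) :
    A = A' := by
  have hp1 := hp.out.one_lt
  have hbin := hA.bin_eq hA' hn hp1 fun m hm => (h m hm).1
  have hbin' : (fun u => A' u / N) = fun u => A u / N := funext fun u => (hbin u).symm
  have hdesc := hA.sameDesc hA' hn hn5 hbin h
  rcases descentsSeparate hn hn5 _ (isBlockStart_blockStart hA.bin_mono) σ (hA.noShortCycle hn)
    (hA.blockMono hn hp1.le) σ' (hA'.noShortCycle hn) (hbin' ▸ hA'.blockMono hn hp1.le) hdesc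
    with hσ | ⟨hn3, hsep⟩
  · subst hσ
    have := cyclic_system_unique (f := σ) hp1 (Q := ((p - 1) * N : ℕ))
      (X := fun u => A u) (Y := fun u => A' u) (r := fun u => shiftDigit p N A σ 0 u)
      (fun u => by
        have := hA.mul_shiftVal hn hp1.le (Nat.zero_le _) u
        rw [shiftVal_zero, shiftVal_zero] at this
        exact_mod_cast this)
      (fun u => by
        have := hA'.mul_shiftVal hn hp1.le (Nat.zero_le _) u
        rw [shiftVal_zero, shiftVal_zero] at this
        have hr : shiftDigit p N A σ 0 u = shiftDigit p N A' σ 0 u := by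
          simp only [shiftDigit, shiftVal_zero, hA.strictMono.lt_iff_lt,
            hA'.strictMono.lt_iff_lt, hbin]
        rw [hr]
        exact_mod_cast this)
    funext u
    exact_mod_cast congrFun this u
  · exact absurd hsep (hA.not_separated hA' hn3 hbin hdesc h)

end IsCyclicSystem

/-- The multiples of `k` by powers of `p` modulo `Q` are pairwise distinct below the exponent
`n`. -/
def IsPrimitiveResidue (p n Q k : ℕ) : Prop :=
  ∀ t, 0 < t → t < n → ¬ k * p ^ t ≡ k [MOD Q]

theorem exists_isCyclicSystem {p n N k : ℕ} (hp : 2 ≤ p) (hn : 1 ≤ n) (hN : (p - 1) * N = p ^ n - 1)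
    (hk : k < (p - 1) * N) (hprim : IsPrimitiveResidue p n ((p - 1) * N) k) :
    ∃ (A : Fin n → ℕ) (σ : Equiv.Perm (Fin n)) (i : Fin n), IsCyclicSystem p N A σ ∧ A i = k ∧
      ∀ u, ∃ t, A u ≡ k * p ^ t [MOD (p - 1) * N] := by
  have hpn : 1 ≤ p ^ n := Nat.one_le_pow _ _ (by omega)
  generalize hQ : (p - 1) * N = Q at *
  have hQ1 : p ^ n = Q + 1 := by omega
  have hpQ : p ^ n ≡ 1 [MOD Q] := by rw [hQ1]; simp [Nat.ModEq]
  have hcop : Nat.Coprime Q p := by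
    have h : Nat.Coprime (Q + 1) Q := by simp
    rw [← hQ1] at h
    exact (Nat.Coprime.coprime_dvd_left (dvd_pow_self p (by omega)) h).symm
  have hcopt (s : ℕ) : Nat.gcd Q (p ^ s) = 1 := hcop.pow_right s
  set S := (range n).image fun t => k * p ^ t % Q with hS
  have hSQ : ∀ x ∈ S, x < Q := fun x hx => by
    obtain ⟨t, -, rfl⟩ := mem_image.mp hx
    exact Nat.mod_lt _ (by omega)
  have hprim' (s t : ℕ) (hst : s < t) (ht : t < s + n) :
      ¬ k * p ^ t ≡ k * p ^ s [MOD Q] := fun h => by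
    rw [show t = (t - s) + s by omega, pow_add, ← mul_assoc] at h
    exact hprim (t - s) (by omega) (by omega) (Nat.ModEq.cancel_right_of_coprime (hcopt s) h)
  have hcard : #S = n := by
    rw [hS, card_image_of_injOn, card_range]
    intro s hs t ht h
    simp only [coe_range, Set.mem_Iio] at hs ht
    rcases lt_trichotomy s t with h1 | h1 | h1
    · exact (hprim' s t h1 (by omega) h.symm).elim
    · exact h1
    · exact (hprim' t s h1 (by omega) h).elim
  set A := S.orderEmbOfFin hcard with hA
  have hmem (u : Fin n) : A u ∈ S := orderEmbOfFin_mem S hcard u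
  have hsurj {x : ℕ} (hx : x ∈ S) : ∃ u, A u = x := by
    have : x ∈ Set.range A := by rw [hA, range_orderEmbOfFin]; exact hx
    exact this
  have hinS (t : ℕ) : k * p ^ t % Q ∈ S := by
    refine mem_image.mpr ⟨t % n, mem_range.mpr (Nat.mod_lt _ (by omega)), ?_⟩
    have h1 : (p ^ n) ^ (t / n) ≡ 1 [MOD Q] := by simpa using hpQ.pow (t / n)
    have h2 := (h1.mul_left (k * p ^ (t % n))).symm
    rw [mul_one, mul_assoc, ← pow_mul, ← pow_add, Nat.mod_add_div] at h2
    exact h2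
  have hpow (u : Fin n) : ∃ t, A u ≡ k * p ^ t [MOD Q] := by
    obtain ⟨t, -, ht⟩ := mem_image.mp (hmem u)
    exact ⟨t, by rw [← ht]; exact Nat.mod_modEq _ _⟩
  have hinj {u v : Fin n} (h : A u ≡ A v [MOD Q]) : u = v :=
    A.injective (h.eq_of_lt_of_lt (hSQ _ (hmem u)) (hSQ _ (hmem v)))
  have hstep (u : Fin n) : ∃ v, p * A u ≡ A v [MOD Q] := by
    obtain ⟨t, ht⟩ := hpow u
    obtain ⟨v, hv⟩ := hsurj (hinS (t + 1))
    refine ⟨v, ?_⟩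
    rw [hv]
    refine (ht.mul_left p).trans (Nat.ModEq.trans ?_ (Nat.mod_modEq _ _).symm)
    rw [pow_succ]
    rw [← mul_assoc, ← mul_assoc, mul_comm p, mul_assoc, mul_comm p, mul_assoc]
  choose f hf using hstep
  have hfinj : Function.Injective f := fun u v h => by
    have := (hf u).trans (h ▸ (hf v).symm)
    exact hinj (Nat.ModEq.cancel_left_of_coprime hcop this)
  set σ : Equiv.Perm (Fin n) := Equiv.ofBijective f (Finite.injective_iff_bijective.mp hfinj)
  have hσ (t : ℕ) (u : Fin n) : p ^ t * A u ≡ A ((σ ^ t) u) [MOD Q] := by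
    induction t with
    | zero => simp [Nat.ModEq]
    | succ t ih =>
      rw [pow_succ' σ, Equiv.Perm.mul_apply, pow_succ', mul_assoc]
      exact (ih.mul_left p).trans (hf _)
  obtain ⟨i, hi⟩ := hsurj (hinS 0)
  refine ⟨A, σ, i, ⟨A.strictMono, fun u => hQ ▸ hSQ _ (hmem u), fun u => hQ ▸ hf u, ?_, ?_⟩, ?_,
    hpow⟩
  · ext u : 1
    refine hinj ((hσ n u).symm.trans ?_)
    simpa using hpQ.mul_right (A u)
  · intro t h0 ht u h
    obtain ⟨s, hs⟩ := hpow u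
    have h1 := hσ t u
    rw [h] at h1
    refine hprim' s (s + t) (by omega) (by omega) ?_
    rw [pow_add, ← mul_assoc, mul_comm _ (p ^ t)]
    exact (hs.symm.mul_left _).trans (h1.trans hs)
  · rw [hi, pow_zero, mul_one, Nat.mod_eq_of_lt hk]

section
open IsLocalRing
variable {R : Type*} [CommRing R] [IsDomain R] [IsLocalRing R] [CharZero R]
  {E : Type*} [Field E] [Fintype E] {p n N : ℕ} [hp : Fact p.Prime] [CharP E p]
  {ω : MulChar E R} {ψ : AddChar E R}

/-- The converse theorem over a local ring, in terms of exponents of the Teichmüller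
character. -/
theorem modEq_mul_pow_of_gaussSum_eq (hω : orderOf ω = p ^ n - 1) (hinj : Function.Injective ω)
    (hn : 2 ≤ n) (hn5 : n ≤ 5) (hE : Fintype.card E = p ^ n)
    (hω1 : ∀ y, (p : R) ∣ ω (1 - y) - (1 - ω y)) (hpR : ¬IsUnit (p : R)) (hψ1 : ψ ≠ 1)
    (hψ : ∀ x, ψ (x ^ p) = ψ x) (hg : ¬IsUnit (gaussSum ω⁻¹ ψ)) (hg0 : gaussSum ω⁻¹ ψ ≠ 0)
    (hN : (p - 1) * N = p ^ n - 1) {k l : ℕ} (hk : k < p ^ n - 1) (hl : l < p ^ n - 1)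
    (hk' : IsPrimitiveResidue p n (p ^ n - 1) k) (hl' : IsPrimitiveResidue p n (p ^ n - 1) l)
    (h : ∀ m ≤ p - 1, gaussSum (ω⁻¹ ^ shiftVal p N m k) ψ = gaussSum (ω⁻¹ ^ shiftVal p N m l) ψ) :
    ∃ t, k ≡ l * p ^ t [MOD p ^ n - 1] := by
  have hp1 : 2 ≤ p := hp.out.two_le
  rw [← hN] at hk hl hk' hl'
  obtain ⟨A, σ, i, hA, hi, -⟩ := exists_isCyclicSystem hp1 (by omega) hN hk hk'
  obtain ⟨A', σ', i', hA', hi', hpow⟩ := exists_isCyclicSystem hp1 (by omega) hN hl hl'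
  have : CharP (ResidueField R) p := by
    rw [CharP.charP_iff_prime_eq_zero hp.out, ← map_natCast (residue R)]
    exact (residue_eq_zero_iff _).mpr hpR
  have hAA := hA.eq_of_sameDigitSums (K := ResidueField R) hA' hn hn5 fun m hm => by
    refine digits_of_gaussSum_eq (by simp) hA.cycle hA'.cycle hω hinj hn hE hω1 hpR hψ1 hψ hg hg0
      hA.shiftDigit_le (hA.exists_shiftDigit_lt hn) hA'.shiftDigit_le (hA'.exists_shiftDigit_lt hn)
      i i' ?_
    rw [hA.digitVal_shiftDigit hn hp1 hm hN, hA'.digitVal_shiftDigit hn hp1 hm hN, hi, hi', h m hm]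
  rw [← hN, ← hi, hAA]
  exact hpow i

end

/-- Roots of unity of order prime to the residue characteristic have distinct reductions. -/
theorem IsLocalRing.eq_of_pow_eq_one_of_residue_eq {R : Type*} [CommRing R] [IsDomain R]
    [IsLocalRing R] {Q : ℕ} (hQ : IsUnit (Q : R)) {a b : R} (ha : a ^ Q = 1) (hb : b ^ Q = 1)
    (h : residue R a = residue R b) : a = b := by
  by_contra hab
  have h1 := Commute.geom_sum₂_mul (Commute.all a b) Q
  rw [ha, hb, sub_self] at h1
  have h2 := (mul_eq_zero.mp h1).resolve_right (sub_ne_zero.mpr hab)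
  have h3 := congrArg (residue R) h2
  rw [map_sum, map_zero] at h3
  simp only [map_mul, map_pow, h] at h3
  rw [geom_sum₂_self] at h3
  have hQ0 : Q ≠ 0 := by rintro rfl; simp at hQ
  have hb0 : residue R b ≠ 0 := fun h0 => by
    have := congrArg (residue R) hb
    rw [map_pow, h0, map_one, zero_pow hQ0] at this
    exact zero_ne_one this
  rcases mul_eq_zero.mp h3 with h4 | h4
  · rw [← map_natCast (residue R)] at h4
    exact (residue_ne_zero_iff_isUnit _).mpr hQ h4
  · exact hb0 (eq_zero_of_pow_eq_zero h4)

section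
open IsLocalRing Polynomial
variable {p n : ℕ} [hp : Fact p.Prime]

theorem IsLocalRing.isUnit_natCast_pow_sub_one {R : Type*} [CommRing R] [IsLocalRing R]
    (hpR : ¬IsUnit (p : R)) (hn : 1 ≤ n) : IsUnit ((p ^ n - 1 : ℕ) : R) := by
  rw [Nat.cast_sub (Nat.one_le_pow _ _ hp.out.pos), Nat.cast_one, Nat.cast_pow]
  by_contra h
  have h1 : (p : R) ^ n ∈ maximalIdeal R := Ideal.pow_mem_of_mem _ hpR _ hn
  have := sub_mem h1 ((mem_maximalIdeal _).mpr h)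
  rw [sub_sub_cancel] at this
  exact this isUnit_one

variable {R : Type*} [CommRing R] [IsDomain R] [IsLocalRing R]
  {E : Type*} [Field E] [Fintype E] [Algebra (ZMod p) E]

theorem exists_algHom_residueField [Algebra (ZMod p) (ResidueField R)]
    (hE : Fintype.card E = p ^ n) (hn : 1 ≤ n) {ζ : R} (hζ : IsPrimitiveRoot ζ (p ^ n - 1)) :
    Nonempty (E →ₐ[ZMod p] ResidueField R) := by
  have hpn : 1 < p ^ n := Nat.one_lt_pow (by omega) hp.out.one_lt
  have h := X_pow_sub_one_eq_prod (by omega) hζ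
  have hsp := FiniteField.isSplittingField_sub E (ZMod p)
  refine ⟨Polynomial.IsSplittingField.lift E (X ^ Fintype.card E - X : (ZMod p)[X]) ?_⟩
  have hR : (X ^ Fintype.card E - X : R[X]).Splits := by
    have : (X ^ Fintype.card E - X : R[X]) = X * (X ^ (p ^ n - 1) - 1) := by
      rw [hE, mul_sub, mul_one, ← pow_succ', Nat.sub_add_cancel hpn.le]
    rw [this, h]
    exact Splits.X.mul (Splits.prod fun i _ => Splits.X_sub_C i)
  simpa using hR.map (residue R)

/-- Existence of the Teichmüller character. -/
theorem exists_teichmuller (hE : Fintype.card E = p ^ n) (hn : 1 ≤ n) (hpR : ¬IsUnit (p : R))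
    {ζ : R} (hζ : IsPrimitiveRoot ζ (p ^ n - 1)) :
    ∃ ω : MulChar E R, Function.Injective ω ∧ ∀ y, (p : R) ∣ ω (1 - y) - (1 - ω y) := by
  have hpn : 1 < p ^ n := Nat.one_lt_pow (by omega) hp.out.one_lt
  have hQ := isUnit_natCast_pow_sub_one (R := R) hpR hn
  have hp0 : residue R (p : R) = 0 := (residue_eq_zero_iff _).mpr hpR
  have : CharP (ResidueField R) p := by
    rwa [CharP.charP_iff_prime_eq_zero hp.out, ← map_natCast (residue R)]
  let _ : Algebra (ZMod p) (ResidueField R) := ZMod.algebra _ p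
  obtain ⟨φ⟩ := exists_algHom_residueField (R := R) hE hn hζ
  have hEpow (x : Eˣ) : (x : E) ^ (p ^ n - 1) = 1 := by
    rw [← hE]; exact FiniteField.pow_card_sub_one_eq_one _ x.ne_zero
  have hex (x : Eˣ) : ∃ a : R, a ^ (p ^ n - 1) = 1 ∧ residue R a = φ x := by
    have h := congrArg (eval₂ (residue R) (φ x)) (X_pow_sub_one_eq_prod (by omega) hζ)
    rw [eval₂_sub, eval₂_one, eval₂_pow, eval₂_X, ← map_pow, hEpow, map_one, sub_self,
      eval₂_finsetProd] at h
    obtain ⟨a, ha, h0⟩ := prod_eq_zero_iff.mp h.symm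
    rw [eval₂_sub, eval₂_X, eval₂_C, sub_eq_zero] at h0
    exact ⟨a, (mem_nthRootsFinset (by omega) _).mp ha, h0.symm⟩
  choose s hs1 hs2 using hex
  have huniq {a b : R} (ha : a ^ (p ^ n - 1) = 1) (hb : b ^ (p ^ n - 1) = 1)
      (h : residue R a = residue R b) : a = b :=
    eq_of_pow_eq_one_of_residue_eq hQ ha hb h
  let f : Eˣ →* R :=
    { toFun := s
      map_one' := huniq (hs1 1) (one_pow _) (by rw [hs2]; simp)
      map_mul' := fun x y => huniq (hs1 _) (by rw [mul_pow, hs1, hs1, one_mul])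
        (by rw [map_mul, hs2, hs2, hs2]; simp) }
  let ω : MulChar E R := MulChar.ofUnitHom f.toHomUnits
  have hω (x : Eˣ) : ω x = s x := by simp [ω, f]
  have hres (y : E) : residue R (ω y) = φ y := by
    rcases eq_or_ne y 0 with rfl | hy
    · rw [MulChar.map_zero, map_zero, map_zero]
    · rw [← Units.val_mk0 hy, hω, hs2]
  have hωq (y : E) : ω y ^ p ^ n = ω y := by
    rcases eq_or_ne y 0 with rfl | hy
    · rw [MulChar.map_zero, zero_pow (by omega)]
    · rw [← Units.val_mk0 hy, hω, ← Nat.sub_add_cancel hpn.le, pow_succ, hs1, one_mul]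
  refine ⟨ω, fun x y h => φ.toRingHom.injective ?_, fun y => ?_⟩
  · change φ x = φ y
    rw [← hres, h, hres]
  have hab : residue R (ω (1 - y)) = residue R (1 - ω y) := by
    rw [map_sub (residue R), hres, hres, map_sub, map_one, map_one]
  have hωa := hωq (1 - y)
  have hωb := hωq y
  generalize ω (1 - y) = a, ω y = b at *
  set δ := a - (1 - b) with hδ
  have hδ0 : residue R δ = 0 := by rw [hδ, map_sub, hab, sub_self]
  have : CharP (R ⧸ Ideal.span {(p : R)}) p := CharP.quotient R p hpR
  have hδq : (p : R) ∣ δ - δ ^ p ^ n := by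
    rw [← Ideal.mem_span_singleton, ← Ideal.Quotient.eq_zero_iff_mem, map_sub, map_pow, hδ]
    simp only [map_sub, map_one]
    rw [sub_pow_char_pow, sub_pow_char_pow, one_pow, ← map_pow, ← map_pow, hωa, hωb, sub_self]
  have hu : IsUnit (1 - δ ^ (p ^ n - 1)) := by
    rw [← residue_ne_zero_iff_isUnit, map_sub, map_pow, hδ0, zero_pow (by omega), map_one, sub_zero]
    exact one_ne_zero
  rw [← hu.dvd_mul_right, mul_sub, mul_one, ← pow_succ', Nat.sub_add_cancel hpn.le]
  exact hδq
end

theorem ValuationSubring.exists_not_isUnit_natCast {p : ℕ} (hp : p.Prime) :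
    ∃ V : ValuationSubring ℂ, ¬IsUnit (p : V) := by
  have hinj : Function.Injective (Int.castRingHom ℂ) := Int.cast_injective
  let e := (Int.castRingHom ℂ).rangeRestrict
  have hI : (Ideal.span {(p : (Int.castRingHom ℂ).range)}) ≠ ⊤ := fun h => by
    obtain ⟨⟨_, z, rfl⟩, hz⟩ := Ideal.mem_span_singleton'.mp (h ▸ Submodule.mem_top (x := 1))
    have h1 := congrArg Subtype.val hz
    simp only [eq_intCast, Subring.coe_mul, SubringClass.coe_natCast,
      OneMemClass.coe_one] at h1
    norm_cast at h1
    exact hp.one_lt.ne' (by have := Int.eq_one_or_neg_one_of_mul_eq_one' h1; omega)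
  obtain ⟨V, -, hV⟩ := Ideal.image_subset_nonunits_valuationSubring _ hI
  refine ⟨V, fun h => ?_⟩
  have h1 : ((p : V) : ℂ) ∈ V.nonunits :=
    hV ⟨(p : (Int.castRingHom ℂ).range), Ideal.mem_span_singleton_self _, by simp⟩
  exact (V.mem_nonunits_iff_exists_mem_maximalIdeal.mp h1).choose_spec h

theorem ValuationSubring.mem_of_pow_eq_one {K : Type*} [Field K] (V : ValuationSubring K) {x : K}
    {m : ℕ} (hm : m ≠ 0) (h : x ^ m = 1) : x ∈ V := by
  refine (V.mem_or_inv_mem x).elim id fun hx => ?_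
  rw [← inv_inv x, inv_eq_of_mul_eq_one_right (b := x⁻¹ ^ (m - 1))]
  · exact pow_mem hx _
  · rw [mul_pow_sub_one hm, inv_pow, h, inv_one]

theorem MulChar.orderOf_eq_of_injective {E R : Type*} [Field E] [Fintype E] [CommRing R]
    {ω : MulChar E R} (hω : Function.Injective ω) : orderOf ω = Fintype.card E - 1 := by
  refine Nat.dvd_antisymm ?_ ?_
  · rw [orderOf_dvd_iff_pow_eq_one]
    exact MulChar.ext fun x => by
      rw [MulChar.pow_apply_coe, ← map_pow, FiniteField.pow_card_sub_one_eq_one _ x.ne_zero,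
        map_one, MulChar.one_apply_coe]
  · obtain ⟨g, hg⟩ := IsCyclic.exists_ofOrder_eq_natCard (α := Eˣ)
    rw [Nat.card_units, Nat.card_eq_fintype_card] at hg
    rw [← hg, orderOf_dvd_iff_pow_eq_one]
    ext
    refine hω ?_
    rw [Units.val_pow_eq_pow_val, map_pow, ← MulChar.pow_apply_coe, pow_orderOf_eq_one,
      MulChar.one_apply_coe, Units.val_one, map_one]

section
open IsLocalRing
variable {R : Type*} [CommRing R] [IsDomain R] [IsLocalRing R] {E : Type*} [Field E] [Fintype E]
  {p : ℕ} [hp : Fact p.Prime] [CharP E p]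

theorem not_isUnit_gaussSum_of_ne_one (hpR : ¬IsUnit (p : R)) {χ : MulChar E R} (hχ : χ ≠ 1)
    (ψ : AddChar E R) : ¬IsUnit (gaussSum χ ψ) := by
  have : CharP (ResidueField R) p := by
    rw [CharP.charP_iff_prime_eq_zero hp.out, ← map_natCast (residue R)]
    exact (residue_eq_zero_iff _).mpr hpR
  have hψ (x : E) : residue R (ψ x) = 1 := by
    have h : residue R (ψ x) ^ p = 1 := by
      rw [← map_pow, ← AddChar.map_nsmul_eq_pow, nsmul_eq_mul, CharP.cast_eq_zero, zero_mul,
        AddChar.map_zero_eq_one, map_one]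
    rw [← sub_eq_zero, ← pow_eq_zero_iff hp.out.ne_zero, sub_pow_char, h, one_pow, sub_self]
  change gaussSum χ ψ ∈ maximalIdeal R
  rw [← residue_eq_zero_iff, gaussSum, map_sum]
  simp_rw [map_mul, hψ, mul_one]
  rw [← map_sum, MulChar.sum_eq_zero_of_ne_one hχ, map_zero]
end

theorem gaussSum_eq_sum_units {E R : Type*} [Field E] [Fintype E] [DecidableEq E] [CommRing R]
    (χ : MulChar E R) (ψ : AddChar E R) : gaussSum χ ψ = ∑ x : Eˣ, χ x * ψ x := by
  refine (Fintype.sum_of_injective Units.val Units.val_injective _ _ (fun x hx => ?_)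
    fun _ => rfl).symm
  rw [MulChar.map_nonunit _ fun h => hx h, zero_mul]

/-- A character fixed by a proper power of Frobenius factors through the norm to the fixed field of
that power. -/
theorem IsRegularChar.exists_ne_apply_pow {p n : ℕ} [hp : Fact p.Prime] {E : Type} [Field E]
    [Fintype E] [CharP E p] (hE : Fintype.card E = p ^ n) {χ : Eˣ →* ℂˣ} (hχ : IsRegularChar χ)
    {t : ℕ} (ht : 0 < t) (htn : t < n) : ∃ x, χ (x ^ p ^ t) ≠ χ x := by
  by_contra! h
  have hp1 := hp.out.one_lt
  let K : Subfield E := (iterateFrobenius E p t).eqLocusField (RingHom.id E)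
  have hK (x : E) : x ∈ K ↔ x ^ p ^ t = x := by
    rw [RingHom.mem_eqLocusField, iterateFrobenius_def, RingHom.id_apply]
  let σ : E ≃ₐ[K] E := AlgEquiv.ofBijective
    { iterateFrobenius E p t with commutes' := fun x => x.2 }
    (Finite.injective_iff_bijective.mp (iterateFrobenius E p t).injective)
  have hσ (x : E) : σ x = x ^ p ^ t := iterateFrobenius_def ..
  have hgen : Subgroup.zpowers σ = ⊤ := by
    rw [← IntermediateField.fixingSubgroup_fixedField (Subgroup.zpowers σ),
      ← IntermediateField.fixingSubgroup_bot]
    congr 1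
    rw [eq_bot_iff]
    intro x hx
    have h1 : σ x = x := hx ⟨σ, Subgroup.mem_zpowers σ⟩
    rw [hσ, ← hK] at h1
    exact IntermediateField.mem_bot.mpr ⟨⟨x, h1⟩, rfl⟩
  have hker : (Units.map (Algebra.norm K : E →* K)).ker ≤ χ.ker := fun x hx => by
    have h1 : Algebra.norm K (x : E) = 1 := congrArg Units.val (MonoidHom.mem_ker.mp hx)
    obtain ⟨y, hy⟩ := groupCohomology.exists_div_of_norm_eq_one (g := σ)
      (fun τ => hgen ▸ Subgroup.mem_top τ) h1
    have h2 : x = y / y ^ p ^ t := by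
      ext
      rw [← hy, hσ, Units.val_div_eq_div_val, Units.val_pow_eq_pow_val]
    rw [MonoidHom.mem_ker, h2, map_div, h, div_self']
  refine hχ K (fun hKtop => ?_) ⟨MonoidHom.liftOfSurjective _
    (FiniteField.unitsMap_norm_surjective K E) ⟨χ, hker⟩, fun x => ?_⟩
  · obtain ⟨g, hg⟩ := IsCyclic.exists_ofOrder_eq_natCard (α := Eˣ)
    rw [Nat.card_units, Nat.card_eq_fintype_card, hE] at hg
    have h1 : g ^ (p ^ t - 1) = 1 := by
      have h2 : (g : E) ^ p ^ t = g := (hK _).mp (hKtop ▸ Subfield.mem_top _)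
      rw [← mul_left_inj g, one_mul, ← pow_succ, Nat.sub_add_cancel (Nat.one_le_pow _ _ hp.out.pos)]
      exact Units.ext h2
    have h3 := Nat.le_of_dvd (Nat.sub_pos_of_lt (Nat.one_lt_pow (by omega) hp1))
      (orderOf_dvd_of_pow_eq_one h1)
    have h4 := Nat.pow_lt_pow_right hp1 htn
    have := Nat.one_le_pow t _ hp.out.pos
    omega
  · exact (MonoidHom.liftOfRightInverse_comp_apply _ _ _ ⟨χ, hker⟩ x).symm

/-- The additive character of `E` attached to an additive character of the prime field, with values
in a valuation ring of `ℂ`. -/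
theorem exists_addChar_trace {p : ℕ} [hp : Fact p.Prime] {E : Type} [Field E]
    [Algebra (ZMod p) E] (V : ValuationSubring ℂ) (ψ : AddChar (ZMod p) ℂ) :
    ∃ Ψ : AddChar E V, ∀ x, (Ψ x : ℂ) = ψ (Algebra.trace (ZMod p) E x) := by
  have hmem (a : ZMod p) : ψ a ∈ V := by
    refine V.mem_of_pow_eq_one hp.out.ne_zero ?_
    rw [← AddChar.map_nsmul_eq_pow, nsmul_eq_mul, CharP.cast_eq_zero, zero_mul,
      AddChar.map_zero_eq_one]
  refine ⟨⟨fun x => ⟨ψ (Algebra.trace (ZMod p) E x), hmem _⟩, ?_, fun x y => ?_⟩, fun x => rfl⟩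
  · ext
    simp
  · ext
    simp [AddChar.map_add_eq_mul]

section
variable {p n : ℕ} [hp : Fact p.Prime] {E : Type} [Field E] [Fintype E]
  [Algebra (ZMod p) E] {V : ValuationSubring ℂ}

theorem trace_pow_prime (x : E) :
    Algebra.trace (ZMod p) E (x ^ p) = Algebra.trace (ZMod p) E x := by
  have h := Algebra.trace_eq_of_algEquiv (FiniteField.frobeniusAlgEquivOfAlgebraic (ZMod p) E) x
  rwa [FiniteField.coe_frobeniusAlgEquivOfAlgebraic, ZMod.card] at h

theorem exists_eq_pow_of_injective {θ : MulChar E V} (hθ : Function.Injective θ) (χ : Eˣ →* ℂˣ) :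
    ∃ k < Fintype.card E - 1, ∀ x : Eˣ, (χ x : ℂ) = ((θ ^ k) x : V) := by
  obtain ⟨g, hg⟩ := IsCyclic.exists_zpow_surjective (G := Eˣ)
  have ho : orderOf g = Fintype.card E - 1 := by
    rw [orderOf_eq_card_of_zpowers_eq_top ((Subgroup.eq_top_iff' _).mpr hg), Nat.card_units,
      Nat.card_eq_fintype_card]
  have hprim : IsPrimitiveRoot (((θ g : V) : ℂ)) (Fintype.card E - 1) := by
    rw [← ho]
    let f : Eˣ →* ℂ := V.subtype.toMonoidHom.comp (θ.toMonoidHom.comp (Units.coeHom E))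
    exact (IsPrimitiveRoot.orderOf g).map_of_injective (f := f)
      (V.subtype_injective.comp (hθ.comp Units.val_injective))
  have hpos : NeZero (Fintype.card E - 1) := ⟨by have := Fintype.one_lt_card (α := E); omega⟩
  obtain ⟨k, hk, hgk⟩ := hprim.eq_pow_of_pow_eq_one (ξ := (χ g : ℂ)) (by
    rw [← Units.val_pow_eq_pow_val, ← map_pow, ← ho, pow_orderOf_eq_one, map_one, Units.val_one])
  refine ⟨k, hk, fun x => ?_⟩
  obtain ⟨i, rfl⟩ := mem_powers_iff_mem_zpowers.mpr (hg x)
  change (χ (g ^ i) : ℂ) = ((θ ^ k) ((g ^ i : Eˣ) : E) : V)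
  rw [map_pow, Units.val_pow_eq_pow_val, ← hgk, Units.val_pow_eq_pow_val, map_pow,
    MulChar.pow_apply_coe]
  push_cast
  rw [pow_right_comm]

theorem twistedGaussSum_eq (hE : Fintype.card E = p ^ n) {N : ℕ} (hN : (p - 1) * N = p ^ n - 1)
    {θ : MulChar E V} {ψ : AddChar (ZMod p) ℂ} {Ψ : AddChar E V}
    (hΨ : ∀ x, (Ψ x : ℂ) = ψ (Algebra.trace (ZMod p) E x)) (j : ℕ) :
    ∃ η : (ZMod p)ˣ →* ℂˣ, ∀ (χ : Eˣ →* ℂˣ) (k : ℕ), (∀ x : Eˣ, (χ x : ℂ) = ((θ ^ k) x : V)) →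
      twistedGaussSum (ZMod p) χ η ψ = (gaussSum (θ ^ (k + j * N)) Ψ : V) := by
  classical
  let f : (ZMod p)ˣ →* ℂ := V.subtype.toMonoidHom.comp ((θ ^ j).toMonoidHom.comp
    ((algebraMap (ZMod p) E).toMonoidHom.comp (Units.coeHom (ZMod p))))
  have hf (a : (ZMod p)ˣ) : f a = ((θ ^ j) (algebraMap (ZMod p) E a) : V) := rfl
  refine ⟨f.toHomUnits, fun χ k hχ => ?_⟩
  rw [twistedGaussSum, gaussSum_eq_sum_units]
  push_cast
  refine sum_congr rfl fun x _ => ?_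
  have hNdiv : (Nat.card E - 1) / (Nat.card (ZMod p) - 1) = N := by
    rw [Nat.card_eq_fintype_card, Nat.card_zmod, hE, ← hN, Nat.mul_div_cancel_left]
    have := hp.out.two_le
    omega
  rw [hΨ, hχ, MonoidHom.coe_toHomUnits, hf, Units.coe_map,
    FiniteField.algebraMap_norm_eq_pow, hNdiv, pow_add, MulChar.mul_apply,
    ← Units.val_pow_eq_pow_val x N, MulChar.pow_apply_coe, MulChar.pow_apply_coe,
    MulChar.pow_apply_coe, Units.val_pow_eq_pow_val, map_pow]
  push_cast
  rw [← pow_mul, mul_comm N j]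
end

/-- The converse theorem in terms of exponents of an inverse Teichmüller character. -/
theorem modEq_mul_pow_of_forall_gaussSum_eq {R : Type*} [CommRing R] [IsDomain R] [IsLocalRing R]
    [CharZero R] {E : Type*} [Field E] [Fintype E] {p n N : ℕ} [hp : Fact p.Prime] [CharP E p]
    {ω : MulChar E R} {ψ : AddChar E R} (hinj : Function.Injective ω)
    (hn : 1 ≤ n) (hn5 : n ≤ 5) (hE : Fintype.card E = p ^ n)
    (hω : ∀ y, (p : R) ∣ ω (1 - y) - (1 - ω y)) (hpR : ¬IsUnit (p : R)) (hψ1 : ψ ≠ 1)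
    (hψ : ∀ x, ψ (x ^ p) = ψ x) (hN : (p - 1) * N = p ^ n - 1) {k l : ℕ} (hk : k < p ^ n - 1)
    (hl : l < p ^ n - 1) (hk' : IsPrimitiveResidue p n (p ^ n - 1) k)
    (hl' : IsPrimitiveResidue p n (p ^ n - 1) l)
    (h : ∀ j, gaussSum (ω⁻¹ ^ (k + j * N)) ψ = gaussSum (ω⁻¹ ^ (l + j * N)) ψ) :
    ∃ t, k ≡ l * p ^ t [MOD p ^ n - 1] := by
  have ho : orderOf ω = p ^ n - 1 := by rw [MulChar.orderOf_eq_of_injective hinj, hE]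
  have ho' : orderOf ω⁻¹ = p ^ n - 1 := by rw [orderOf_inv, ho]
  have hp1 := hp.out.two_le
  rcases hn.eq_or_lt with rfl | hn
  · rw [pow_one] at *
    obtain rfl : N = 1 := Nat.eq_of_mul_eq_mul_left (by omega : 0 < p - 1) (by omega)
    have h1 := h (p - 1 - k)
    rw [mul_one, show k + (p - 1 - k) = p - 1 by omega, ← ho', pow_orderOf_eq_one,
      gaussSum_one_left hψ1] at h1
    have h2 : ω⁻¹ ^ (l + (orderOf ω⁻¹ - k)) = 1 := by
      by_contra h3
      exact not_isUnit_gaussSum_of_ne_one hpR h3 ψ (h1 ▸ isUnit_one.neg)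
    obtain ⟨c, hc⟩ := orderOf_dvd_of_pow_eq_one h2
    rw [ho'] at hc
    have hc1 : c = 1 := by
      have hc0 : 0 < c := Nat.pos_of_ne_zero (by rintro rfl; omega)
      have hc2 : c < 2 := by
        by_contra hc2
        have := Nat.mul_le_mul_left (p - 1) (not_lt.mp hc2)
        omega
      omega
    subst hc1
    exact ⟨0, by rw [show k = l by omega]; simp [Nat.ModEq]⟩
  · have hω1 : ω⁻¹ ≠ 1 := fun h1 => by
      rw [h1, orderOf_one] at ho'
      have := Nat.pow_le_pow_right hp.out.pos hn
      nlinarith [Nat.sub_add_cancel (Nat.one_le_pow n p hp.out.pos)]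
    have hshift {m : ℕ} (hm : m ≤ p - 1) (x : ℕ) :
        ω⁻¹ ^ shiftVal p N m x = ω⁻¹ ^ (x + (p - 1 - m) * N) := by
      rw [pow_eq_pow_iff_modEq, ho', ← hN]
      refine Nat.ModEq.add_right_cancel' (m * N) ((shiftVal_add_modEq hm).trans ?_)
      rw [add_assoc, ← add_mul, Nat.sub_add_cancel hm]
      simp [Nat.ModEq]
    refine modEq_mul_pow_of_gaussSum_eq ho hinj hn hn5 hE hω hpR hψ1 hψ
      (not_isUnit_gaussSum_of_ne_one hpR hω1 ψ) ?_ hN hk hl hk' hl' fun m hm => ?_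
    · refine gaussSum_ne_zero_of_nontrivial ?_ hω1 (AddChar.IsPrimitive.of_ne_one hψ1)
      rw [hE]
      exact_mod_cast (pow_pos hp.out.pos n).ne'
    · rw [hshift hm, hshift hm, h]

/-- The exponent of a regular character is primitive. -/
theorem IsRegularChar.isPrimitiveResidue {p n : ℕ} [hp : Fact p.Prime] {E : Type} [Field E]
    [Fintype E] [CharP E p] (hE : Fintype.card E = p ^ n) {V : ValuationSubring ℂ}
    {θ : MulChar E V} (hθ : orderOf θ = p ^ n - 1) {χ : Eˣ →* ℂˣ} (hχ : IsRegularChar χ) {k : ℕ}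
    (hk : ∀ x : Eˣ, (χ x : ℂ) = ((θ ^ k) x : V)) : IsPrimitiveResidue p n (p ^ n - 1) k := by
  intro t ht htn h
  obtain ⟨x, hx⟩ := hχ.exists_ne_apply_pow hE ht htn
  refine hx (Units.ext ?_)
  rw [hk, hk, Units.val_pow_eq_pow_val, map_pow, ← MulChar.pow_apply_coe, ← pow_mul,
    pow_eq_pow_iff_modEq.mpr (hθ ▸ h)]

end

theorem gauss_sum_converse_GL_n_le_five
    (p n : ℕ) [hp : Fact p.Prime] (hn1 : 1 ≤ n) (hn5 : n ≤ 5)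
    (E : Type) [Field E] [Fintype E] [Algebra (ZMod p) E]
    (hE : Fintype.card E = p ^ n)
    (ψ : AddChar (ZMod p) ℂ) (hψ : ψ ≠ 1)
    (χ₁ χ₂ : Eˣ →* ℂˣ) (hχ₁ : IsRegularChar χ₁) (hχ₂ : IsRegularChar χ₂)
    (h : ∀ η : (ZMod p)ˣ →* ℂˣ,
      twistedGaussSum (ZMod p) χ₁ η ψ = twistedGaussSum (ZMod p) χ₂ η ψ) :
    ∃ j : ℕ, ∀ x : Eˣ, χ₁ x = χ₂ (x ^ p ^ j) := by
  have hE' : CharP E p := charP_of_injective_algebraMap (algebraMap (ZMod p) E).injective p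
  have hpn : 1 < p ^ n := Nat.one_lt_pow (by omega) hp.out.one_lt
  obtain ⟨V, hV⟩ := ValuationSubring.exists_not_isUnit_natCast hp.out
  have hζ := Complex.isPrimitiveRoot_exp (p ^ n - 1) (by omega)
  obtain ⟨ω, hinj, hω⟩ := exists_teichmuller (R := V) hE hn1 hV
    (ζ := ⟨_, V.mem_of_pow_eq_one (by omega) hζ.pow_eq_one⟩)
    (hζ.of_map_of_injective (f := V.subtype) V.subtype_injective)
  obtain ⟨Ψ, hΨ⟩ := exists_addChar_trace (E := E) V ψ
  have hinj' : Function.Injective (ω⁻¹ : MulChar E V) := fun x y hxy => by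
    rw [MulChar.inv_apply', MulChar.inv_apply'] at hxy
    exact inv_injective (hinj hxy)
  obtain ⟨k, hk, hk1⟩ := exists_eq_pow_of_injective hinj' χ₁
  obtain ⟨l, hl, hl1⟩ := exists_eq_pow_of_injective hinj' χ₂
  have hN := Nat.mul_div_cancel' (by simpa using Nat.sub_dvd_pow_sub_pow p 1 n : p - 1 ∣ p ^ n - 1)
  have hord : orderOf ω⁻¹ = p ^ n - 1 := by rw [MulChar.orderOf_eq_of_injective hinj', hE]
  have hΨ1 : Ψ ≠ 1 := fun h1 => hψ <| by
    ext a
    obtain ⟨x, rfl⟩ := Algebra.trace_surjective (ZMod p) E a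
    rw [← hΨ, h1]
    simp
  obtain ⟨t, ht⟩ := modEq_mul_pow_of_forall_gaussSum_eq hinj hn1 hn5 hE hω hV hΨ1
    (fun x => Subtype.ext (by rw [hΨ, hΨ, trace_pow_prime])) hN (hE ▸ hk) (hE ▸ hl)
    (hχ₁.isPrimitiveResidue hE hord hk1) (hχ₂.isPrimitiveResidue hE hord hl1) fun j => by
      obtain ⟨η, hη⟩ := twistedGaussSum_eq hE hN hΨ (θ := ω⁻¹) j
      exact Subtype.ext (by rw [← hη χ₁ k hk1, ← hη χ₂ l hl1, h])
  refine ⟨t, fun x => Units.ext ?_⟩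
  rw [hk1, hl1, Units.val_pow_eq_pow_val, map_pow, ← MulChar.pow_apply_coe, ← pow_mul,
    pow_eq_pow_iff_modEq.mpr (hord ▸ ht)]
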